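/- Let n ≥ 3, m ≥ 1, and for each ε ∈ (0, 4/(n−2)) let u_ε be a radial Dirichlet solution with exactly m−1 interior zeros, with zeros ρ_{k,ε} and critical points δ_{k,ε}. Then, as ε → 0⁺: (i) |u_ε(δ_{k,ε})|·(κ_n ε)^{(2k−1)/2} → (n(n−2))^{(n−2)/4}·Γ(m−k+1)/(m^{1/2}·Γ(m)) for every k ∈ {1,…,m}; (ii) if m ≥ 2, δ_{k,ε}·(κ_n ε)^{−2(kn−1)/(n(n−2))} → (m−k)^{1/n}·(m^{1/2}·Γ(m)/Γ(m−k+1))^{2/(n−2)} for every k ∈ {1,…,m−1}; (iii) |u_ε'(ρ_{k,ε})|·(κ_n ε)^{(2kn−3n+2)/(2(n−2))} → n^{(n−2)/4}·(n−2)^{(n+2)/4}·(m−k+1)^{(n−1)/(n−2)}·(Γ(m−k+1)/(m^{1/2}·Γ(m)))^{n/(n−2)} for every k ∈ {1,…,m}; (iv) if m ≥ 2, ρ_{k,ε}·(κ_n ε)^{−2(k−1)/(n−2)} → (m−k+1)^{−1/(n−2)}·(m^{1/2}·Γ(m)/Γ(m−k+1))^{2/(n−2)} for every k ∈ {2,…,m}.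 -/

import Mathlib

open Real Set Filter Topology MeasureTheory

noncomputable section

/-- `κ_n = ((n-2)/4) · Γ(n/2)² / Γ(n)`. -/
def kappa (n : ℕ) : ℝ :=
  (((n : ℝ) - 2) / 4) * Real.Gamma ((n : ℝ) / 2) ^ 2 / Real.Gamma (n : ℝ)

/-- `p_ε = (n+2)/(n-2) - ε`. -/
def pEps (n : ℕ) (ε : ℝ) : ℝ := ((n : ℝ) + 2) / ((n : ℝ) - 2) - ε

/-- `u ∈ C²([0,1])` is a radial solution of `-Δu = |u|^{p-1} u` on the unit ball of `ℝⁿ`,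
written in the radial variable: `(r^{n-1} u')' = -|u|^{p-1} u · r^{n-1}` on `(0,1]`,
with `u'(0) = 0`. -/
def IsRadialSolution (n : ℕ) (p : ℝ) (u : ℝ → ℝ) : Prop :=
  ContDiffOn ℝ 2 u (Set.Icc 0 1) ∧ deriv u 0 = 0 ∧
    ∀ r ∈ Set.Ioc (0 : ℝ) 1,
      deriv (fun s => s ^ (n - 1) * deriv u s) r = -(|u r| ^ (p - 1) * u r * r ^ (n - 1))

/-- Radial Dirichlet solution with exactly `m-1` interior zeros, together with the
decreasing enumeration of its zeros `ρ 1 = 1 > ρ 2 > … > ρ m > 0` in `(0,1]` and of its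
critical points `1 > δ 1 > … > δ m = 0` in `[0,1]`, interlaced as
`0 = δ m < ρ m < δ (m-1) < … < δ 1 < ρ 1 = 1`. -/
def DirichletData (n : ℕ) (p : ℝ) (m : ℕ) (u : ℝ → ℝ) (ρ δ : ℕ → ℝ) : Prop :=
  IsRadialSolution n p u ∧ u 1 = 0 ∧ ρ 1 = 1 ∧ δ m = 0 ∧
    (∀ k, 1 ≤ k → k ≤ m → δ k < ρ k) ∧
    (∀ k, 1 ≤ k → k + 1 ≤ m → ρ (k + 1) < δ k) ∧
    {r : ℝ | r ∈ Set.Ioc (0 : ℝ) 1 ∧ u r = 0} = ρ '' Set.Icc 1 m ∧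
    {r : ℝ | r ∈ Set.Icc (0 : ℝ) 1 ∧ deriv u r = 0} = δ '' Set.Icc 1 m

/-- Radial Neumann solution with exactly `m-1` interior zeros, together with the
decreasing enumeration of its zeros `1 > ρ 1 > … > ρ (m-1) > 0` in `(0,1)` and of its
critical points `δ 1 = 1 > δ 2 > … > δ m = 0` in `[0,1]`, interlaced as
`0 = δ m < ρ (m-1) < δ (m-1) < … < ρ 1 < δ 1 = 1`. -/
def NeumannData (n : ℕ) (p : ℝ) (m : ℕ) (u : ℝ → ℝ) (ρ δ : ℕ → ℝ) : Prop :=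
  IsRadialSolution n p u ∧ deriv u 1 = 0 ∧ δ 1 = 1 ∧ δ m = 0 ∧
    (∀ k, 1 ≤ k → k ≤ m - 1 → ρ k < δ k) ∧
    (∀ k, 1 ≤ k → k ≤ m - 1 → δ (k + 1) < ρ k) ∧
    {r : ℝ | r ∈ Set.Ioo (0 : ℝ) 1 ∧ u r = 0} = ρ '' Set.Icc 1 (m - 1) ∧
    {r : ℝ | r ∈ Set.Icc (0 : ℝ) 1 ∧ deriv u r = 0} = δ '' Set.Icc 1 m

/-- A nontrivial radial Dirichlet solution with exactly `m-1` interior zeros. -/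
def DirichletSol (n : ℕ) (p : ℝ) (m : ℕ) (u : ℝ → ℝ) : Prop :=
  IsRadialSolution n p u ∧ u 1 = 0 ∧ (∃ r ∈ Set.Icc (0 : ℝ) 1, u r ≠ 0) ∧
    ∃ Z : Finset ℝ, (Z : Set ℝ) = {r | r ∈ Set.Ioo (0 : ℝ) 1 ∧ u r = 0} ∧ Z.card = m - 1

/-- A nontrivial radial Neumann solution with exactly `m-1` interior zeros. -/
def NeumannSol (n : ℕ) (p : ℝ) (m : ℕ) (u : ℝ → ℝ) : Prop :=
  IsRadialSolution n p u ∧ deriv u 1 = 0 ∧ (∃ r ∈ Set.Icc (0 : ℝ) 1, u r ≠ 0) ∧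
    ∃ Z : Finset ℝ, (Z : Set ℝ) = {r | r ∈ Set.Ioo (0 : ℝ) 1 ∧ u r = 0} ∧ Z.card = m - 1

lemma mono_aux {f f' : ℝ → ℝ} {a b : ℝ} (hc : ContinuousOn f (Icc a b))
    (hd : ∀ r ∈ Ioo a b, HasDerivAt f (f' r) r) (h : ∀ r ∈ Ioo a b, 0 ≤ f' r)
    {x y : ℝ} (hx : a ≤ x) (hxy : x ≤ y) (hy : y ≤ b) : f x ≤ f y := by
  have : MonotoneOn f (Icc a b) := by
    apply monotoneOn_of_deriv_nonneg (convex_Icc a b) hc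
    · rw [interior_Icc]; intro r hr; exact (hd r hr).differentiableAt.differentiableWithinAt
    · rw [interior_Icc]; intro r hr; rw [(hd r hr).deriv]; exact h r hr
  exact this ⟨hx, hxy.trans hy⟩ ⟨hx.trans hxy, hy⟩ hxy

lemma anti_aux {f f' : ℝ → ℝ} {a b : ℝ} (hc : ContinuousOn f (Icc a b))
    (hd : ∀ r ∈ Ioo a b, HasDerivAt f (f' r) r) (h : ∀ r ∈ Ioo a b, f' r ≤ 0)
    {x y : ℝ} (hx : a ≤ x) (hxy : x ≤ y) (hy : y ≤ b) : f y ≤ f x := by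
  have := mono_aux (f := fun r => - f r) (f' := fun r => - f' r) hc.neg
    (fun r hr => (hd r hr).neg) (fun r hr => by have := h r hr; linarith) hx hxy hy
  linarith

structure RArc (ν : ℕ) (p d b : ℝ) (v g : ℝ → ℝ) : Prop where
  hd : 0 ≤ d
  hdb : d < b
  cv : ContinuousOn v (Icc d b)
  cg : ContinuousOn g (Icc d b)
  dv : ∀ r ∈ Ioo d b, HasDerivAt v (g r / r ^ (ν + 1)) r
  dg : ∀ r ∈ Ioo d b, HasDerivAt g (-(v r ^ p * r ^ (ν + 1))) r
  pos : ∀ r ∈ Ioo d b, 0 < v r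
  vd : v d = 1
  gd : g d = 0
  vb : v b = 0

structure LArc (ν : ℕ) (p a d : ℝ) (v g : ℝ → ℝ) : Prop where
  ha : 0 < a
  had : a < d
  cv : ContinuousOn v (Icc a d)
  cg : ContinuousOn g (Icc a d)
  dv : ∀ r ∈ Ioo a d, HasDerivAt v (g r / r ^ (ν + 1)) r
  dg : ∀ r ∈ Ioo a d, HasDerivAt g (-(v r ^ p * r ^ (ν + 1))) r
  pos : ∀ r ∈ Ioo a d, 0 < v r
  va : v a = 0
  vd : v d = 1
  gd : g d = 0

namespace RArc
variable {ν : ℕ} {p d b : ℝ} {v g : ℝ → ℝ}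

lemma g_nonpos (h : RArc ν p d b v g) {r : ℝ} (h1 : d ≤ r) (h2 : r ≤ b) : g r ≤ 0 := by
  rw [← h.gd]
  refine anti_aux h.cg h.dg ?_ le_rfl h1 h2
  intro r hr
  have := h.hd.trans_lt hr.1
  have := Real.rpow_nonneg (h.pos r hr).le p
  have : 0 ≤ v r ^ p * r ^ (ν+1) := by positivity
  linarith

lemma v_anti (h : RArc ν p d b v g) {x y : ℝ} (h1 : d ≤ x) (h2 : x ≤ y) (h3 : y ≤ b) :
    v y ≤ v x := by
  refine anti_aux h.cv h.dv ?_ h1 h2 h3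
  intro r hr
  have := h.hd.trans_lt hr.1
  exact div_nonpos_of_nonpos_of_nonneg (h.g_nonpos hr.1.le hr.2.le) (by positivity)

lemma v_le_one (h : RArc ν p d b v g) {x : ℝ} (h1 : d ≤ x) (h3 : x ≤ b) : v x ≤ 1 := by
  have := h.v_anti le_rfl h1 h3
  rwa [h.vd] at this

lemma v_nonneg (h : RArc ν p d b v g) {x : ℝ} (h1 : d ≤ x) (h3 : x ≤ b) : 0 ≤ v x := by
  have := h.v_anti h1 h3 le_rfl
  rwa [h.vb] at this

lemma g_ge (h : RArc ν p d b v g) (hp : 0 ≤ p) {r : ℝ} (h1 : d ≤ r) (h2 : r ≤ b) :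
    -((r ^ (ν+2) - d ^ (ν+2)) / ((ν:ℝ)+2)) ≤ g r := by
  have hν : (0:ℝ) < (ν:ℝ) + 2 := by positivity
  have := mono_aux (f := fun r => g r + r ^ (ν+2) / ((ν:ℝ)+2))
    (f' := fun r => -(v r ^ p * r ^ (ν + 1)) + r ^ (ν+1)) (a := d) (b := b)
    (h.cg.add (by fun_prop)) ?_ ?_ le_rfl h1 h2
  · simp only [h.gd] at this
    rw [sub_div]; linarith
  · intro r hr
    have := (h.dg r hr).add ((hasDerivAt_pow (ν+2) r).div_const ((ν:ℝ)+2))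
    refine this.congr_deriv ?_
    push_cast; simp; field_simp
  · intro r hr
    have h0 := h.hd.trans_lt hr.1
    have : v r ^ p ≤ 1 := Real.rpow_le_one (h.pos r hr).le (h.v_le_one hr.1.le hr.2.le) hp
    have h3 : 0 < r ^ (ν+1) := by positivity
    nlinarith

lemma g_ge' (h : RArc ν p d b v g) (hp : 0 ≤ p) {r : ℝ} (h1 : d ≤ r) (h2 : r ≤ b) :
    -(r ^ (ν+2) / ((ν:ℝ)+2)) ≤ g r := by
  have := h.g_ge hp h1 h2
  have h3 : 0 ≤ d ^ (ν+2) / ((ν:ℝ)+2) := by have := h.hd; positivity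
  rw [sub_div] at this; linarith

lemma v_ge (h : RArc ν p d b v g) (hp : 0 ≤ p) {r : ℝ} (h1 : d ≤ r) (h2 : r ≤ b) :
    1 - r ^ 2 / (2 * ((ν:ℝ)+2)) ≤ v r := by
  have hν : (0:ℝ) < (ν:ℝ) + 2 := by positivity
  have := mono_aux (f := fun r => v r + r ^ 2 / (2 * ((ν:ℝ)+2)))
    (f' := fun r => g r / r ^ (ν + 1) + r / ((ν:ℝ)+2)) (a := d) (b := b)
    (h.cv.add (by fun_prop)) ?_ ?_ le_rfl h1 h2
  · simp only [h.vd] at this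
    have h3 : 0 ≤ d ^ 2 / (2 * ((ν:ℝ)+2)) := by positivity
    linarith
  · intro r hr
    have := (h.dv r hr).add ((hasDerivAt_pow 2 r).div_const (2 * ((ν:ℝ)+2)))
    refine this.congr_deriv ?_
    simp; field_simp
  · intro r hr
    have h0 := h.hd.trans_lt hr.1
    have := h.g_ge' hp hr.1.le hr.2.le
    have h4 : r / ((ν:ℝ)+2) = (r ^ (ν+2) / ((ν:ℝ)+2)) / r ^ (ν+1) := by
      field_simp
      ring
    rw [h4, ← add_div]
    apply div_nonneg _ (by positivity)
    linarith

lemma one_lt_b (h : RArc ν p d b v g) (hp : 0 ≤ p) : 1 < b := by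
  have h1 := h.v_ge hp h.hdb.le le_rfl
  rw [h.vb] at h1
  have h0 := h.hd.trans_lt h.hdb
  have hν : (0:ℝ) < 2 * ((ν:ℝ) + 2) := by positivity
  have : 1 ≤ b ^ 2 / (2 * ((ν:ℝ)+2)) := by linarith
  rw [le_div_iff₀ hν] at this
  have : (0:ℝ) ≤ ν := by positivity
  nlinarith

lemma v_pos (h : RArc ν p d b v g) {r : ℝ} (h1 : d ≤ r) (h2 : r < b) : 0 < v r := by
  rcases h1.eq_or_lt with rfl | h1
  · rw [h.vd]; norm_num
  · exact h.pos r ⟨h1, h2⟩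

lemma Q_deriv (hν : 1 ≤ ν) {r : ℝ} (hr : 0 < r) (hv : 0 < v r)
    (h1 : HasDerivAt v (g r / r ^ (ν + 1)) r)
    (h2 : HasDerivAt g (-(v r ^ p * r ^ (ν + 1))) r) (c₁ : ℝ) :
    HasDerivAt (fun r => c₁ * (r ^ (ν+2) * v r ^ (p+1)) + (ν:ℝ) / 2 * (g r * v r) +
      g r ^ 2 / r ^ ν / 2)
      ((c₁ * (ν+2) - ν/2) * (r ^ (ν+1) * v r ^ (p+1)) +
        (c₁ * (p+1) - 1) * (r * v r ^ p * g r)) r := by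
  have e1 := ((hasDerivAt_pow (ν+2) r).mul (h1.rpow_const (p := p+1) (Or.inl hv.ne'))).const_mul c₁
  have e2 := (h2.mul h1).const_mul ((ν:ℝ)/2)
  have e3 := ((h2.pow 2).div (hasDerivAt_pow ν r) (by positivity)).div_const 2
  refine ((e1.add e2).add e3).congr_deriv ?_
  obtain ⟨k, rfl⟩ : ∃ k, ν = k + 1 := ⟨ν - 1, by omega⟩
  have : v r ^ (p+1) = v r ^ p * v r := Real.rpow_add_one hv.ne' p
  rw [this]
  push_cast
  simp
  field_simp
  ring

end RArc

namespace RArc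
variable {ν : ℕ} {p d b : ℝ} {v g : ℝ → ℝ}

lemma cont_sq (h : RArc ν p d b v g) (hp : 0 ≤ p) :
    ContinuousOn (fun r => g r ^ 2 / r ^ ν) (Icc d b) := by
  intro r hr
  by_cases h0 : r = 0
  · have hd0 : d = 0 := le_antisymm (by rw [← h0]; exact hr.1) h.hd
    subst h0
    have hg0 : g 0 = 0 := by have := h.gd; rwa [hd0] at this
    have : (fun r => g r ^ 2 / r ^ ν) 0 = 0 := by simp [hg0]
    unfold ContinuousWithinAt
    rw [this]
    apply squeeze_zero_norm' (a := fun r => r ^ (ν+4))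
    · filter_upwards [self_mem_nhdsWithin] with r hr
      rcases hr.1.eq_or_lt with h1 | h1
      · rw [← h1, hd0]; simp [hg0]
      · have hr0 : 0 < r := h.hd.trans_lt h1
        have h3 := h.g_ge' hp hr.1 hr.2
        have h4 := h.g_nonpos hr.1 hr.2
        have h5 : r ^ (ν+2) / ((ν:ℝ)+2) ≤ r ^ (ν+2) := by
          apply div_le_self (by positivity)
          have : (0:ℝ) ≤ ν := by positivity
          linarith
        rw [Real.norm_of_nonneg (by positivity), div_le_iff₀ (by positivity), ← pow_add]
        have : g r ^ 2 ≤ (r ^ (ν+2))^2 := by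
          apply sq_le_sq'
          · linarith
          · have : 0 < r ^ (ν+2) := by positivity
            linarith
        refine this.trans (le_of_eq ?_)
        ring
    · have : Continuous (fun r : ℝ => r ^ (ν+4)) := by fun_prop
      have := this.tendsto 0
      simp only [ne_eq, Nat.add_eq_zero_iff, OfNat.ofNat_ne_zero, and_false, not_false_eq_true, zero_pow] at this
      exact this.mono_left nhdsWithin_le_nhds
  · exact ((h.cg r hr).pow 2).div (by fun_prop) (pow_ne_zero _ h0)

lemma cont_Q (h : RArc ν p d b v g) (hp : 0 ≤ p) (c₁ : ℝ) :
    ContinuousOn (fun r => c₁ * (r ^ (ν+2) * v r ^ (p+1)) + (ν:ℝ) / 2 * (g r * v r) +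
      g r ^ 2 / r ^ ν / 2) (Icc d b) := by
  have h1 := h.cont_sq hp
  have h2 : ContinuousOn (fun r => v r ^ (p+1)) (Icc d b) :=
    h.cv.rpow_const (fun x hx => Or.inr (by linarith))
  have h3 := h.cv
  have h4 := h.cg
  fun_prop

lemma Q_nonneg (h : RArc ν p d b v g) (hν : 1 ≤ ν) (hp : 0 ≤ p) (hp2 : p * ν ≤ ν + 4)
    {r : ℝ} (h1 : d ≤ r) (h2 : r ≤ b) :
    0 ≤ (ν:ℝ) / (2 * (ν+2)) * (r ^ (ν+2) * v r ^ (p+1)) + (ν:ℝ) / 2 * (g r * v r) +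
      g r ^ 2 / r ^ ν / 2 := by
  have hν0 : (0:ℝ) < ν := by positivity
  have := mono_aux (h.cont_Q hp ((ν:ℝ) / (2 * (ν+2))))
    (fun r hr => Q_deriv hν (h.hd.trans_lt hr.1) (h.pos r hr) (h.dv r hr) (h.dg r hr) _) ?_
    le_rfl h1 h2
  · refine le_trans ?_ this
    simp only [h.vd, h.gd]
    have := h.hd
    simp
    positivity
  · intro r hr
    have h0 := h.hd.trans_lt hr.1
    have e1 : (ν:ℝ) / (2 * (ν+2)) * (ν+2) - ν/2 = 0 := by field_simp; ring
    rw [e1, zero_mul, zero_add]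
    apply mul_nonneg_of_nonpos_of_nonpos
    · rw [sub_nonpos, div_mul_eq_mul_div, div_le_one (by positivity)]
      linarith
    · apply mul_nonpos_of_nonneg_of_nonpos
      · have := Real.rpow_nonneg (h.pos r hr).le p
        positivity
      · exact h.g_nonpos hr.1.le hr.2.le

lemma q_mono (h : RArc ν p d b v g) (hν : 1 ≤ ν) (hp : 0 ≤ p) (hp2 : p * ν ≤ ν + 4)
    {x y : ℝ} (h1 : d < x) (h2 : x ≤ y) (h3 : y < b) :
    (-g x) * (x ^ (ν+2))⁻¹ * v x ^ (-((2:ℝ)/ν+1)) ≤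
    (-g y) * (y ^ (ν+2))⁻¹ * v y ^ (-((2:ℝ)/ν+1)) := by
  have hν0 : (0:ℝ) < ν := by positivity
  have hx0 : 0 < x := h.hd.trans_lt h1
  have hI : ∀ r ∈ Icc x y, r ∈ Ioo d b := fun r hr => ⟨h1.trans_le hr.1, hr.2.trans_lt h3⟩
  have key : ∀ r ∈ Icc x y, HasDerivAt (fun r => (-g r) * (r ^ (ν+2))⁻¹ * v r ^ (-((2:ℝ)/ν+1)))
      ((r ^ (ν+3))⁻¹ * v r ^ (-((2:ℝ)/ν+1) - 1) * (2 * (ν+2) / ν) *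
        ((ν:ℝ) / (2 * (ν+2)) * (r ^ (ν+2) * v r ^ (p+1)) + (ν:ℝ) / 2 * (g r * v r) +
      g r ^ 2 / r ^ ν / 2)) r := by
    intro r hr
    have hr' := hI r hr
    have hr0 : 0 < r := h.hd.trans_lt hr'.1
    have hv := h.pos r hr'
    have e1 := ((h.dg r hr').neg.mul ((hasDerivAt_pow (ν+2) r).inv (by positivity))).mul
      ((h.dv r hr').rpow_const (p := -((2:ℝ)/ν+1)) (Or.inl hv.ne'))
    refine e1.congr_deriv ?_
    have f1 : v r ^ (p+1) = v r ^ p * v r := Real.rpow_add_one hv.ne' p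
    have f2 : v r ^ (-((2:ℝ)/ν+1)) = v r ^ (-((2:ℝ)/ν+1) - 1) * v r := by
      rw [← Real.rpow_add_one hv.ne']; congr 1; ring
    rw [f1]
    simp only [Pi.neg_apply, Pi.mul_apply, Pi.inv_apply]
    rw [f2]
    generalize v r ^ (-((2:ℝ)/ν+1) - 1) = X
    push_cast
    simp
    field_simp
    ring
  refine mono_aux (f := fun r => (-g r) * (r ^ (ν+2))⁻¹ * v r ^ (-((2:ℝ)/ν+1))) (a := x) (b := y)
    (fun r hr => (key r hr).continuousAt.continuousWithinAt)
    (fun r hr => key r (Ioo_subset_Icc_self hr)) ?_ le_rfl h2 le_rfl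
  intro r hr
  have hr' := hI r (Ioo_subset_Icc_self hr)
  have hr0 : 0 < r := h.hd.trans_lt hr'.1
  have := h.Q_nonneg hν hp hp2 hr'.1.le hr'.2.le
  have := Real.rpow_nonneg (h.pos r hr').le (-((2:ℝ)/ν+1) - 1)
  positivity

/-- the quantity controlling the upper bound -/
def tht (ν : ℕ) (p d τ : ℝ) : ℝ :=
  (1 - τ ^ 2 / (2 * ((ν:ℝ)+2))) ^ p * (1 - (d / τ) ^ (ν+2)) * (1 - τ ^ 2)

lemma w_ge (h : RArc ν p d b v g) (hν : 1 ≤ ν) (hp : 0 ≤ p) (hp2 : p * ν ≤ ν + 4)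
    {τ : ℝ} (hτ : d < τ) (hτ1 : τ < 1) {r : ℝ} (h1 : d ≤ r) (h2 : r < b) :
    tht ν p d τ * (1 + r ^ 2 / ((ν+2) * ν)) ≤ v r ^ (-((2:ℝ)/ν)) := by
  have hν0 : (1:ℝ) ≤ ν := by exact_mod_cast hν
  have hd := h.hd
  have hτ0 : 0 < τ := h.hd.trans_lt hτ
  have hτb : τ < b := hτ1.trans (h.one_lt_b hp)
  set κ₀ := (1 - τ ^ 2 / (2 * ((ν:ℝ)+2))) ^ p with hκ₀
  have hτ2 : τ ^ 2 / (2 * ((ν:ℝ)+2)) ≤ 1 := by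
    rw [div_le_one (by positivity)]; nlinarith
  have hτ3 : 0 ≤ τ ^ 2 / (2 * ((ν:ℝ)+2)) := by positivity
  have hκ0 : 0 ≤ κ₀ := Real.rpow_nonneg (by linarith) _
  have hκ1 : κ₀ ≤ 1 := Real.rpow_le_one (by linarith) (by linarith) hp
  have hdt : (d/τ)^(ν+2) ≤ 1 := pow_le_one₀ (by positivity) (by rw [div_le_one hτ0]; exact hτ.le)
  have hdt0 : 0 ≤ (d/τ)^(ν+2) := by positivity
  set q₀ := κ₀ * (1 - (d/τ)^(ν+2)) with hq₀
  have hq0 : 0 ≤ q₀ := mul_nonneg hκ0 (by linarith)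
  have hq1 : q₀ ≤ 1 := mul_le_one₀ hκ1 (by linarith) (by linarith)
  have hth : tht ν p d τ = q₀ * (1 - τ^2) := rfl
  have hτ4 : 0 ≤ 1 - τ^2 := by nlinarith
  have hvr := h.v_pos h1 h2
  have hN : (1:ℝ) ≤ (ν+2) * ν := by nlinarith
  rw [hth]
  rcases le_total r τ with hrt | hrt
  · have : 1 ≤ v r ^ (-((2:ℝ)/ν)) := by
      apply Real.one_le_rpow_of_pos_of_le_one_of_nonpos hvr (h.v_le_one h1 h2.le)
      have : 0 ≤ (2:ℝ)/ν := by positivity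
      linarith
    refine le_trans ?_ this
    have hr0 : 0 ≤ r := h.hd.trans h1
    have : r ^ 2 / ((ν+2) * (ν:ℝ)) ≤ τ^2 := by
      apply (div_le_self (by positivity) hN).trans
      gcongr
    calc q₀ * (1 - τ^2) * (1 + r ^ 2 / ((ν+2) * ν)) ≤ 1 * (1 - τ^2) * (1 + τ^2) := by gcongr
      _ ≤ 1 := by nlinarith [sq_nonneg (τ^2)]
  · -- lower bound for q at τ
    have hg : κ₀ * (τ^(ν+2) - d^(ν+2)) / (ν+2) ≤ - g τ := by
      have := anti_aux (f := fun r => g r + κ₀ * r ^ (ν+2) / ((ν:ℝ)+2))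
        (f' := fun r => -(v r ^ p * r ^ (ν + 1)) + κ₀ * r ^ (ν+1)) (a := d) (b := τ)
        ((h.cg.mono (Icc_subset_Icc le_rfl hτb.le)).add (by fun_prop)) ?_ ?_ le_rfl hτ.le le_rfl
      · simp only [h.gd] at this
        rw [mul_sub, sub_div]; linarith
      · intro r hr
        have := (h.dg r ⟨hr.1, hr.2.trans hτb⟩).add
          (((hasDerivAt_pow (ν+2) r).const_mul κ₀).div_const ((ν:ℝ)+2))
        refine this.congr_deriv ?_
        push_cast; simp; field_simp
      · intro r hr
        have h0 := h.hd.trans_lt hr.1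
        have h5 := h.v_ge hp hr.1.le (hr.2.trans hτb).le
        have h6 : r ^ 2 / (2 * ((ν:ℝ)+2)) ≤ τ ^ 2 / (2 * ((ν:ℝ)+2)) := by
          have := hr.2.le
          gcongr
        have : κ₀ ≤ v r ^ p := Real.rpow_le_rpow (by linarith) (by linarith) hp
        have h3 : 0 < r ^ (ν+1) := by positivity
        nlinarith
    have hq : q₀ / (ν+2) ≤ (-g τ) * (τ ^ (ν+2))⁻¹ * v τ ^ (-((2:ℝ)/ν+1)) := by
      have a1 : 1 ≤ v τ ^ (-((2:ℝ)/ν+1)) := by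
        apply Real.one_le_rpow_of_pos_of_le_one_of_nonpos (h.v_pos hτ.le hτb)
          (h.v_le_one hτ.le hτb.le)
        have : 0 ≤ (2:ℝ)/ν := by positivity
        linarith
      have a2 : q₀ / (ν+2) ≤ (-g τ) * (τ ^ (ν+2))⁻¹ := by
        rw [← div_eq_mul_inv, le_div_iff₀ (by positivity)]
        refine le_trans (le_of_eq ?_) hg
        rw [hq₀, div_pow]
        field_simp
      have a3 : 0 ≤ q₀ / (ν+2) := by positivity
      nlinarith
    have := mono_aux (f := fun r => v r ^ (-((2:ℝ)/ν)) - q₀ * r^2 / ((ν+2)*ν))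
      (f' := fun r => (2 / ν) * r * ((-g r) * (r ^ (ν+2))⁻¹ * v r ^ (-((2:ℝ)/ν+1)) - q₀ / (ν+2)))
      (a := τ) (b := r) ?_ ?_ ?_ le_rfl hrt le_rfl
    · have a1 : 1 ≤ v τ ^ (-((2:ℝ)/ν)) := by
        apply Real.one_le_rpow_of_pos_of_le_one_of_nonpos (h.v_pos hτ.le hτb)
          (h.v_le_one hτ.le hτb.le)
        have : 0 ≤ (2:ℝ)/ν := by positivity
        linarith
      have a2 : q₀ * τ^2 / ((ν+2)*ν) ≤ τ^2 := by
        apply (div_le_self (by positivity) hN).trans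
        nlinarith
      have a3 : q₀ * (1 - τ^2) * (1 + r ^ 2 / ((ν+2) * ν)) =
        q₀ * (1 - τ^2) + (1 - τ^2) * (q₀ * r^2 / ((ν+2)*ν)) := by ring
      have a4 : 0 ≤ q₀ * r^2 / ((ν+2)*ν) := by positivity
      rw [a3]
      nlinarith
    · intro x hx
      apply ContinuousAt.continuousWithinAt
      have hx' : x ∈ Ioo d b := ⟨hτ.trans_le hx.1, hx.2.trans_lt h2⟩
      have := (h.dv x hx').continuousAt.rpow_const (p := -((2:ℝ)/ν)) (Or.inl (h.pos x hx').ne')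
      exact this.sub (by fun_prop)
    · intro x hx
      have hx' : x ∈ Ioo d b := ⟨hτ.trans hx.1, hx.2.trans h2⟩
      have hx0 := h.hd.trans_lt hx'.1
      have := ((h.dv x hx').rpow_const (p := -((2:ℝ)/ν)) (Or.inl (h.pos x hx').ne')).sub
        (((hasDerivAt_pow 2 x).const_mul q₀).div_const (((ν:ℝ)+2)*ν))
      refine this.congr_deriv ?_
      have e : -((2:ℝ)/ν) - 1 = -((2:ℝ)/ν+1) := by ring
      rw [e]
      generalize v x ^ (-((2:ℝ)/ν+1)) = X
      simp
      field_simp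
      ring
    · intro x hx
      have hx' : x ∈ Ioo d b := ⟨hτ.trans hx.1, hx.2.trans h2⟩
      have hx0 := h.hd.trans_lt hx'.1
      have := h.q_mono hν hp hp2 hτ hx.1.le hx'.2
      apply mul_nonneg (by positivity)
      linarith

lemma v_le (h : RArc ν p d b v g) (hν : 1 ≤ ν) (hp : 0 ≤ p) (hp2 : p * ν ≤ ν + 4)
    {τ : ℝ} (hτ : d < τ) (hτ1 : τ < 1) (hθ : 0 < tht ν p d τ) {r : ℝ} (h1 : d ≤ r) (h2 : r ≤ b) :
    v r ≤ (tht ν p d τ * (1 + r ^ 2 / ((ν+2) * ν))) ^ (-((ν:ℝ)/2)) := by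
  have hν0 : (0:ℝ) < ν := by positivity
  have hpos : 0 < tht ν p d τ * (1 + r ^ 2 / ((ν+2) * ν)) := by positivity
  rcases h2.eq_or_lt with rfl | h2
  · rw [h.vb]; positivity
  have := h.w_ge hν hp hp2 hτ hτ1 h1 h2
  have hv := h.v_pos h1 h2
  have e : v r = (v r ^ (-((2:ℝ)/ν))) ^ (-((ν:ℝ)/2)) := by
    rw [← Real.rpow_mul hv.le]
    have : -((2:ℝ)/ν) * (-((ν:ℝ)/2)) = 1 := by field_simp
    rw [this, Real.rpow_one]
  rw [e]
  exact Real.rpow_le_rpow_of_nonpos hpos this (by linarith [div_pos hν0 two_pos])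

/-- the limiting bubble -/
def U (ν : ℕ) (r : ℝ) : ℝ := (1 + r ^ 2 / ((ν+2) * ν)) ^ (-((ν:ℝ)/2))

/-- its flux -/
def gU (ν : ℕ) (r : ℝ) : ℝ := - (r ^ (ν+2) / (ν+2) * (1 + r ^ 2 / ((ν+2) * ν)) ^ (-((ν:ℝ)/2) - 1))

lemma U_base (ν : ℕ) (r : ℝ) : 1 ≤ 1 + r ^ 2 / (((ν:ℝ)+2) * ν) := by
  have : 0 ≤ r ^ 2 / (((ν:ℝ)+2) * ν) := by positivity
  linarith

lemma U_pos (ν : ℕ) (r : ℝ) : 0 < U ν r := Real.rpow_pos_of_pos (by linarith [U_base ν r]) _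

lemma U_le_one (ν : ℕ) (r : ℝ) : U ν r ≤ 1 :=
  Real.rpow_le_one_of_one_le_of_nonpos (U_base ν r) (by simp; positivity)

lemma U_anti (ν : ℕ) {r s : ℝ} (hr : 0 ≤ r) (hrs : r ≤ s) : U ν s ≤ U ν r := by
  apply Real.rpow_le_rpow_of_nonpos (by linarith [U_base ν r]) _ (by simp; positivity)
  gcongr

lemma U_deriv (hν : 1 ≤ ν) {r : ℝ} (hr : 0 < r) : HasDerivAt (U ν) (gU ν r / r ^ (ν+1)) r := by
  have hν0 : (0:ℝ) < ν := by positivity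
  have hb := U_base ν r
  have e1 : HasDerivAt (fun r : ℝ => 1 + r ^ 2 / (((ν:ℝ)+2) * ν)) (2 * r / (((ν:ℝ)+2) * ν)) r := by
    have := ((hasDerivAt_pow 2 r).div_const (((ν:ℝ)+2) * ν)).const_add 1
    simpa using this
  have e2 := e1.rpow_const (p := -((ν:ℝ)/2)) (Or.inl (by linarith))
  refine e2.congr_deriv ?_
  unfold gU
  field_simp
  ring

lemma gU_deriv (hν : 1 ≤ ν) {r : ℝ} (hr : 0 < r) :
    HasDerivAt (gU ν) (-(U ν r ^ (((ν:ℝ)+4)/ν) * r ^ (ν+1))) r := by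
  have hν0 : (0:ℝ) < ν := by positivity
  have hb := U_base ν r
  have e1 : HasDerivAt (fun r : ℝ => 1 + r ^ 2 / (((ν:ℝ)+2) * ν)) (2 * r / (((ν:ℝ)+2) * ν)) r := by
    have := ((hasDerivAt_pow 2 r).div_const (((ν:ℝ)+2) * ν)).const_add 1
    simpa using this
  have e2 := (((hasDerivAt_pow (ν+2) r).div_const ((ν:ℝ)+2)).mul
    (e1.rpow_const (p := -((ν:ℝ)/2) - 1) (Or.inl (by linarith)))).neg
  refine e2.congr_deriv ?_
  have f1 : U ν r ^ (((ν:ℝ)+4)/ν) = (1 + r ^ 2 / (((ν:ℝ)+2) * ν)) ^ (-((ν:ℝ)/2) - 1 - 1) := by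
    unfold U
    rw [← Real.rpow_mul (by linarith)]
    congr 1; field_simp; ring
  have f2 : (1 + r ^ 2 / (((ν:ℝ)+2) * ν)) ^ (-((ν:ℝ)/2) - 1) =
    (1 + r ^ 2 / (((ν:ℝ)+2) * ν)) ^ (-((ν:ℝ)/2) - 1 - 1) * (1 + r ^ 2 / (((ν:ℝ)+2) * ν)) := by
    rw [← Real.rpow_add_one (by linarith)]; congr 1; ring
  rw [f1, f2]
  generalize (1 + r ^ 2 / (((ν:ℝ)+2) * ν)) ^ (-((ν:ℝ)/2) - 1 - 1) = X
  push_cast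
  simp
  field_simp
  ring

lemma gU_nonpos (ν : ℕ) {r : ℝ} (hr : 0 ≤ r) : gU ν r ≤ 0 := by
  unfold gU
  have := Real.rpow_nonneg (by linarith [U_base ν r] : 0 ≤ 1 + r ^ 2 / (((ν:ℝ)+2) * ν)) (-((ν:ℝ)/2) - 1)
  have : 0 ≤ r ^ (ν+2) / ((ν:ℝ)+2) := by positivity
  simp only [neg_nonpos]
  positivity

lemma U_cont (ν : ℕ) : Continuous (U ν) := by
  unfold U
  apply Continuous.rpow_const (by fun_prop)
  intro x; left; linarith [U_base ν x]

lemma gU_cont (ν : ℕ) : Continuous (gU ν) := by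
  unfold gU
  have : Continuous (fun r : ℝ => (1 + r ^ 2 / (((ν:ℝ)+2) * ν)) ^ (-((ν:ℝ)/2) - 1)) := by
    apply Continuous.rpow_const (by fun_prop)
    intro x; left; linarith [U_base ν x]
  fun_prop

lemma v_le' (h : RArc ν p d b v g) (hν : 1 ≤ ν) (hp : 0 ≤ p) (hp2 : p * ν ≤ ν + 4)
    {τ : ℝ} (hτ : d < τ) (hτ1 : τ < 1) (hθ : 0 < tht ν p d τ) {r : ℝ} (h1 : d ≤ r) (h2 : r ≤ b) :
    v r ≤ tht ν p d τ ^ (-((ν:ℝ)/2)) * U ν r := by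
  have := h.v_le hν hp hp2 hτ hτ1 hθ h1 h2
  rwa [Real.mul_rpow hθ.le (by linarith [U_base ν r])] at this

/-- lower bound for the solution given the upper bound -/
lemma v_ge_U (h : RArc ν p d b v g) (hν : 1 ≤ ν) (hp : 0 ≤ p)
    {K M R : ℝ} (hM : 0 ≤ M) (hK : ∀ r, d ≤ r → r ≤ b → v r ≤ K * U ν r)
    (hKM : K ^ p * U ν R ^ (p - ((ν:ℝ)+4)/ν) ≤ M) (hK0 : 0 ≤ K) (hp2 : p ≤ ((ν:ℝ)+4)/ν)
    {r : ℝ} (h1 : d ≤ r) (h2 : r ≤ b) (h3 : r ≤ R) : 1 - M + M * U ν r ≤ v r := by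
  have hν0 : (0:ℝ) < ν := by positivity
  have gb : ∀ s, d ≤ s → s ≤ b → s ≤ R → M * gU ν s ≤ g s := by
    intro s hs1 hs2 hs3
    have := mono_aux (f := fun s => g s - M * gU ν s)
      (f' := fun s => -(v s ^ p * s ^ (ν + 1)) - M * (-(U ν s ^ (((ν:ℝ)+4)/ν) * s ^ (ν+1))))
      (a := d) (b := s) ?_ ?_ ?_ le_rfl hs1 le_rfl
    · simp only [h.gd] at this
      have h5 := gU_nonpos ν h.hd
      nlinarith
    · have := gU_cont ν
      exact (h.cg.mono (Icc_subset_Icc le_rfl hs2)).sub (by fun_prop)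
    · intro x hx
      have hx0 := h.hd.trans_lt hx.1
      exact (h.dg x ⟨hx.1, hx.2.trans_le hs2⟩).sub ((gU_deriv hν hx0).const_mul M)
    · intro x hx
      have hx0 := h.hd.trans_lt hx.1
      have hx2 : x ≤ b := hx.2.le.trans hs2
      have a1 : v x ^ p ≤ (K * U ν x) ^ p :=
        Real.rpow_le_rpow (h.v_nonneg hx.1.le hx2) (hK x hx.1.le hx2) hp
      rw [Real.mul_rpow hK0 (U_pos ν x).le] at a1
      have a2 : U ν x ^ p = U ν x ^ (((ν:ℝ)+4)/ν) * U ν x ^ (p - ((ν:ℝ)+4)/ν) := by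
        rw [← Real.rpow_add (U_pos ν x)]; congr 1; ring
      have a3 : U ν x ^ (p - ((ν:ℝ)+4)/ν) ≤ U ν R ^ (p - ((ν:ℝ)+4)/ν) := by
        apply Real.rpow_le_rpow_of_nonpos (U_pos ν R) (U_anti ν hx0.le (hx.2.le.trans hs3))
        linarith
      have a4 := Real.rpow_pos_of_pos (U_pos ν x) (((ν:ℝ)+4)/ν)
      have a5 : 0 ≤ K ^ p := Real.rpow_nonneg hK0 p
      have : v x ^ p ≤ M * U ν x ^ (((ν:ℝ)+4)/ν) := by
        calc v x ^ p ≤ K ^ p * (U ν x ^ (((ν:ℝ)+4)/ν) * U ν x ^ (p - ((ν:ℝ)+4)/ν)) := by rw [← a2]; exact a1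
          _ ≤ K ^ p * (U ν x ^ (((ν:ℝ)+4)/ν) * U ν R ^ (p - ((ν:ℝ)+4)/ν)) := by gcongr
          _ = (K ^ p * U ν R ^ (p - ((ν:ℝ)+4)/ν)) * U ν x ^ (((ν:ℝ)+4)/ν) := by ring
          _ ≤ _ := by gcongr
      have : 0 < x ^ (ν+1) := by positivity
      nlinarith
  have := mono_aux (f := fun s => v s - M * U ν s)
      (f' := fun s => g s / s ^ (ν+1) - M * (gU ν s / s ^ (ν+1)))
      (a := d) (b := r) ?_ ?_ ?_ le_rfl h1 le_rfl
  · simp only [h.vd] at this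
    have h5 := U_le_one ν d
    nlinarith
  · have := U_cont ν
    exact (h.cv.mono (Icc_subset_Icc le_rfl h2)).sub (by fun_prop)
  · intro x hx
    have hx0 := h.hd.trans_lt hx.1
    exact (h.dv x ⟨hx.1, hx.2.trans_le h2⟩).sub ((U_deriv hν hx0).const_mul M)
  · intro x hx
    have hx0 := h.hd.trans_lt hx.1
    have := gb x hx.1.le (hx.2.le.trans h2) (hx.2.le.trans h3)
    rw [← mul_div_assoc, ← sub_div]
    apply div_nonneg _ (by positivity)
    linarith

/-- Flux as an integral -/
lemma flux (h : RArc ν p d b v g) (hp : 0 ≤ p) :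
    - g b = ∫ r in d..b, v r ^ p * r ^ (ν+1) := by
  have := intervalIntegral.integral_eq_sub_of_hasDerivAt_of_le h.hdb.le h.cg
    (f' := fun r => -(v r ^ p * r ^ (ν+1))) h.dg ?_
  · rw [intervalIntegral.integral_neg, h.gd] at this; linarith
  · apply ContinuousOn.intervalIntegrable
    rw [uIcc_of_le h.hdb.le]
    exact ((h.cv.rpow_const (fun _ _ => Or.inr hp)).mul (by fun_prop)).neg

/-- Pohozaev identity -/
lemma poho (h : RArc ν p d b v g) (hν : 1 ≤ ν) (hp : 0 ≤ p) :
    g b ^ 2 / b ^ ν / 2 = d ^ (ν+2) / (p+1) +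
      (((ν:ℝ)+2) / (p+1) - ν/2) * ∫ r in d..b, v r ^ (p+1) * r ^ (ν+1) := by
  have hp1 : p + 1 ≠ 0 := by linarith
  have := intervalIntegral.integral_eq_sub_of_hasDerivAt_of_le h.hdb.le (h.cont_Q hp (1/(p+1)))
    (f' := fun r => (((ν:ℝ)+2) / (p+1) - ν/2) * (v r ^ (p+1) * r ^ (ν+1))) ?_ ?_
  · rw [intervalIntegral.integral_const_mul] at this
    rw [this, h.vb, h.gd, h.vd, Real.zero_rpow hp1]
    simp; ring
  · intro r hr
    refine (Q_deriv hν (h.hd.trans_lt hr.1) (h.pos r hr) (h.dv r hr) (h.dg r hr) _).congr_deriv ?_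
    field_simp
    ring
  · apply ContinuousOn.intervalIntegrable
    rw [uIcc_of_le h.hdb.le]
    have := h.cv.rpow_const (p := p+1) (fun _ _ => Or.inr (by linarith))
    fun_prop

end RArc

namespace LArc
variable {ν : ℕ} {p a d : ℝ} {v g : ℝ → ℝ}

lemma g_anti (h : LArc ν p a d v g) {x y : ℝ} (h1 : a ≤ x) (h2 : x ≤ y) (h3 : y ≤ d) :
    g y ≤ g x := by
  refine anti_aux h.cg h.dg ?_ h1 h2 h3
  intro r hr
  have := h.ha.trans hr.1
  have := Real.rpow_nonneg (h.pos r hr).le p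
  have : 0 ≤ v r ^ p * r ^ (ν+1) := by positivity
  linarith

lemma g_nonneg (h : LArc ν p a d v g) {r : ℝ} (h1 : a ≤ r) (h2 : r ≤ d) : 0 ≤ g r := by
  have := h.g_anti h1 h2 le_rfl
  rwa [h.gd] at this

lemma v_mono (h : LArc ν p a d v g) {x y : ℝ} (h1 : a ≤ x) (h2 : x ≤ y) (h3 : y ≤ d) :
    v x ≤ v y := by
  refine mono_aux h.cv h.dv ?_ h1 h2 h3
  intro r hr
  have := h.ha.trans hr.1
  exact div_nonneg (h.g_nonneg hr.1.le hr.2.le) (by positivity)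

lemma v_le_one (h : LArc ν p a d v g) {r : ℝ} (h1 : a ≤ r) (h2 : r ≤ d) : v r ≤ 1 := by
  have := h.v_mono h1 h2 le_rfl
  rwa [h.vd] at this

lemma inv_deriv (ν : ℕ) {r : ℝ} (hr : 0 < r) (c : ℝ) :
    HasDerivAt (fun r : ℝ => c * (r ^ ν)⁻¹) (-(c * ν / r ^ (ν+1))) r := by
  rcases Nat.eq_zero_or_pos ν with rfl | hν
  · simpa using hasDerivAt_const r c
  refine (((hasDerivAt_pow ν r).inv (by positivity)).const_mul c).congr_deriv ?_
  obtain ⟨k, rfl⟩ : ∃ k, ν = k + 1 := ⟨ν - 1, by omega⟩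
  simp
  field_simp
  ring

lemma inv_cont (ν : ℕ) (ha : 0 < a) (c : ℝ) :
    ContinuousOn (fun r : ℝ => c * (r ^ ν)⁻¹) (Icc a d) := by
  intro r hr
  exact (inv_deriv ν (ha.trans_le hr.1) c).continuousAt.continuousWithinAt

lemma x_ge (h : LArc ν p a d v g) (hν : 1 ≤ ν) : ν * a ^ ν ≤ g a := by
  have ha := h.ha
  have hd := h.ha.trans h.had
  have hν0 : (0:ℝ) < ν := by positivity
  have := anti_aux (f := fun r => v r + g a / ν * (r ^ ν)⁻¹)
    (f' := fun r => g r / r ^ (ν+1) + -(g a / ν * ν / r ^ (ν+1))) (a := a) (b := d)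
    (h.cv.add (inv_cont ν h.ha _)) ?_ ?_ le_rfl h.had.le le_rfl
  · simp only [h.vd, h.va, zero_add] at this
    have h1 : 0 ≤ g a / ν * (d ^ ν)⁻¹ := by
      have := h.g_nonneg le_rfl h.had.le
      positivity
    have h2 : 1 ≤ g a / ν * (a ^ ν)⁻¹ := by linarith
    rw [← div_eq_mul_inv, div_div, le_div_iff₀ (by positivity)] at h2
    linarith
  · intro r hr
    exact (h.dv r hr).add (inv_deriv ν (h.ha.trans hr.1) _)
  · intro r hr
    have hr0 := h.ha.trans hr.1
    rw [div_mul_cancel₀ _ hν0.ne', ← sub_eq_add_neg, ← sub_div]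
    apply div_nonpos_of_nonpos_of_nonneg _ (by positivity)
    linarith [h.g_anti le_rfl hr.1.le hr.2.le]

lemma g_ge (h : LArc ν p a d v g) (hp : 0 ≤ p) {r : ℝ} (h1 : a ≤ r) (h2 : r ≤ d) :
    g a + a ^ (ν+2) / ((ν:ℝ)+2) ≤ g r + r ^ (ν+2) / ((ν:ℝ)+2) := by
  have hν : (0:ℝ) < (ν:ℝ) + 2 := by positivity
  refine mono_aux (f := fun r => g r + r ^ (ν+2) / ((ν:ℝ)+2))
    (f' := fun r => -(v r ^ p * r ^ (ν + 1)) + r ^ (ν+1)) (a := a) (b := d)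
    (h.cg.add (by fun_prop)) ?_ ?_ le_rfl h1 h2
  · intro r hr
    have := (h.dg r hr).add ((hasDerivAt_pow (ν+2) r).div_const ((ν:ℝ)+2))
    refine this.congr_deriv ?_
    push_cast; simp; field_simp
  · intro r hr
    have h0 := h.ha.trans hr.1
    have : v r ^ p ≤ 1 := Real.rpow_le_one (h.pos r hr).le (h.v_le_one hr.1.le hr.2.le) hp
    have h3 : 0 < r ^ (ν+1) := by positivity
    nlinarith

lemma ga_le (h : LArc ν p a d v g) (hp : 0 ≤ p) : g a ≤ d ^ (ν+2) / ((ν:ℝ)+2) := by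
  have := h.g_ge hp h.had.le le_rfl
  have ha := h.ha
  have : 0 ≤ a ^ (ν+2) / ((ν:ℝ)+2) := by positivity
  have := h.gd
  linarith

lemma v_ge (h : LArc ν p a d v g) (hν : 1 ≤ ν) (hp : 0 ≤ p) {r : ℝ} (h1 : a ≤ r) (h2 : r ≤ d) :
    g a / (ν * a ^ ν) * (1 - (a/r) ^ ν) - r ^ 2 / (2 * ((ν:ℝ)+2)) ≤ v r := by
  have ha := h.ha
  have hr0 := ha.trans_le h1
  have hν0 : (0:ℝ) < ν := by positivity
  have := mono_aux (f := fun r => v r + g a / ν * (r ^ ν)⁻¹ + r ^ 2 / (2 * ((ν:ℝ)+2)))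
    (f' := fun r => g r / r ^ (ν+1) + -(g a / ν * ν / r ^ (ν+1)) + r / ((ν:ℝ)+2)) (a := a) (b := d)
    ((h.cv.add (inv_cont ν h.ha _)).add (by fun_prop)) ?_ ?_ le_rfl h1 h2
  · simp only [h.va, zero_add] at this
    have h3 : 0 ≤ a ^ 2 / (2 * ((ν:ℝ)+2)) := by positivity
    have e : g a / (ν * a ^ ν) * (1 - (a/r) ^ ν) = g a / ν * (a ^ ν)⁻¹ - g a / ν * (r ^ ν)⁻¹ := by
      rw [div_pow]; field_simp
    rw [e]; linarith
  · intro r hr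
    refine (((h.dv r hr).add (inv_deriv ν (h.ha.trans hr.1) _)).add
      ((hasDerivAt_pow 2 r).div_const (2 * ((ν:ℝ)+2)))).congr_deriv ?_
    simp; field_simp
  · intro r hr
    have hr0 := h.ha.trans hr.1
    have h4 : r / ((ν:ℝ)+2) = (r ^ (ν+2) / ((ν:ℝ)+2)) / r ^ (ν+1) := by
      field_simp
      ring
    rw [div_mul_cancel₀ _ hν0.ne', ← sub_eq_add_neg, ← sub_div, h4, ← add_div]
    apply div_nonneg _ (by positivity)
    have := h.g_ge hp hr.1.le hr.2.le
    have : 0 ≤ a ^ (ν+2) / ((ν:ℝ)+2) := by positivity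
    linarith

lemma crude (h : LArc ν p a d v g) (hν : 1 ≤ ν) (hp : 0 ≤ p) :
    g a / (ν * a ^ ν) ≤ 2 ^ (ν+2) * (1 + a ^ 2) := by
  have ha := h.ha
  have hd := h.ha.trans h.had
  have hν0 : (1:ℝ) ≤ ν := by exact_mod_cast hν
  have h8 : (8:ℝ) ≤ 2 ^ (ν+2) := by
    calc (8:ℝ) = 2 ^ 3 := by norm_num
      _ ≤ _ := pow_le_pow_right₀ (by norm_num) (by omega)
  rcases le_total (2 * a) d with h1 | h1
  · have h2 := h.v_ge hν hp (r := 2 * a) (by linarith) h1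
    have h3 := h.v_le_one (r := 2 * a) (by linarith) h1
    have e : a / (2 * a) = 1 / 2 := by field_simp
    rw [e] at h2
    have h4 : ((1:ℝ)/2) ^ ν ≤ 1 / 2 := by
      calc ((1:ℝ)/2) ^ ν ≤ (1/2) ^ 1 := pow_le_pow_of_le_one (by norm_num) (by norm_num) hν
        _ = _ := by norm_num
    have h5 : (2 * a) ^ 2 / (2 * ((ν:ℝ)+2)) ≤ a ^ 2 := by
      rw [div_le_iff₀ (by positivity)]; nlinarith [sq_nonneg a]
    have h6 : 0 ≤ g a / (ν * a ^ ν) := div_nonneg (h.g_nonneg le_rfl h.had.le) (by positivity)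
    have h7 : g a / (ν * a ^ ν) * (1/2) ≤ 1 + a ^ 2 := by nlinarith
    nlinarith [sq_nonneg a]
  · have h2 := h.ga_le hp
    rw [div_le_iff₀ (by positivity)]
    calc g a ≤ d ^ (ν+2) / ((ν:ℝ)+2) := h2
      _ ≤ d ^ (ν+2) := div_le_self (by positivity) (by linarith)
      _ ≤ (2 * a) ^ (ν+2) := by gcongr
      _ = 2 ^ (ν+2) * (a ^ 2) * (1 * a ^ ν) := by ring
      _ ≤ 2 ^ (ν+2) * (1 + a ^ 2) * (ν * a ^ ν) := by gcongr; linarith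

lemma cont_P (h : LArc ν p a d v g) (hp : 0 ≤ p) (c₁ : ℝ) :
    ContinuousOn (fun r => c₁ * (r ^ (ν+2) * v r ^ (p+1)) + (ν:ℝ) / 2 * (g r * v r) +
      g r ^ 2 / r ^ ν / 2) (Icc a d) := by
  have h1 : ContinuousOn (fun r => g r ^ 2 / r ^ ν) (Icc a d) := by
    apply (h.cg.pow 2).div (by fun_prop)
    intro r hr
    have := h.ha.trans_le hr.1
    positivity
  have h2 : ContinuousOn (fun r => v r ^ (p+1)) (Icc a d) :=
    h.cv.rpow_const (fun x hx => Or.inr (by linarith))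
  have h3 := h.cv
  have h4 := h.cg
  fun_prop

lemma poho1 (h : LArc ν p a d v g) (hν : 1 ≤ ν) (hp : 0 ≤ p) (hp2 : p * ν ≤ ν + 4) :
    g a ^ 2 / a ^ ν / 2 ≤ d ^ (ν+2) / (p+1) := by
  have hp1 : 0 < p + 1 := by linarith
  have := mono_aux (h.cont_P hp (1/(p+1)))
    (f' := fun r => (((ν:ℝ)+2) / (p+1) - ν/2) * (v r ^ (p+1) * r ^ (ν+1))) ?_ ?_
    le_rfl h.had.le le_rfl
  · rw [h.va, h.gd, h.vd, Real.zero_rpow hp1.ne'] at this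
    simp at this
    refine this.trans (le_of_eq ?_)
    ring
  · intro r hr
    refine (RArc.Q_deriv hν (h.ha.trans hr.1) (h.pos r hr) (h.dv r hr) (h.dg r hr) _).congr_deriv ?_
    field_simp
    ring
  · intro r hr
    have hr0 := h.ha.trans hr.1
    have := Real.rpow_nonneg (h.pos r hr).le (p+1)
    apply mul_nonneg _ (by positivity)
    rw [sub_nonneg, div_le_div_iff₀ (by norm_num) hp1]
    linarith

lemma poho2 (h : LArc ν p a d v g) (hν : 1 ≤ ν) (hp : 0 ≤ p) (hp2 : p * ν ≤ ν + 4) :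
    (ν:ℝ) / (2 * (ν+2)) * d ^ (ν+2) ≤ g a ^ 2 / a ^ ν / 2 := by
  have hp1 : 0 < p + 1 := by linarith
  have hc : 0 ≤ (((ν:ℝ)+2) / (p+1) - ν/2) := by
    rw [sub_nonneg, div_le_div_iff₀ (by norm_num) hp1]
    linarith
  have ha := h.ha
  have hpow : Continuous (fun r : ℝ => (((ν:ℝ)+2) / (p+1) - ν/2) / (ν+2) * r ^ (ν+2)) := by fun_prop
  have := anti_aux ((h.cont_P hp (1/(p+1))).sub hpow.continuousOn)
    (f' := fun r => (((ν:ℝ)+2) / (p+1) - ν/2) * (v r ^ (p+1) * r ^ (ν+1)) -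
      (((ν:ℝ)+2) / (p+1) - ν/2) * r ^ (ν+1)) ?_ ?_
    le_rfl h.had.le le_rfl
  · simp only [Pi.sub_apply] at this
    rw [h.va, h.gd, h.vd, Real.zero_rpow hp1.ne'] at this
    simp at this
    have h1 : 0 ≤ (((ν:ℝ)+2) / (p+1) - ν/2) / (ν+2) * a ^ (ν+2) := by positivity
    have e : (ν:ℝ) / (2 * (ν+2)) * d ^ (ν+2) = (p+1)⁻¹ * d ^ (ν+2) -
      (((ν:ℝ)+2) / (p+1) - ν/2) / (ν+2) * d ^ (ν+2) := by field_simp; ring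
    rw [e]
    linarith
  · intro r hr
    refine ((RArc.Q_deriv hν (h.ha.trans hr.1) (h.pos r hr) (h.dv r hr) (h.dg r hr) _).sub
      ((hasDerivAt_pow (ν+2) r).const_mul ((((ν:ℝ)+2) / (p+1) - ν/2) / (ν+2)))).congr_deriv ?_
    push_cast
    simp
    field_simp
    ring
  · intro r hr
    have hr0 := h.ha.trans hr.1
    have h5 : v r ^ (p+1) ≤ 1 :=
      Real.rpow_le_one (h.pos r hr).le (h.v_le_one hr.1.le hr.2.le) hp1.le
    have h6 : v r ^ (p+1) * r ^ (ν+1) ≤ 1 * r ^ (ν+1) := by gcongr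
    rw [← mul_sub]
    apply mul_nonpos_of_nonneg_of_nonpos hc
    linarith

lemma ad_le (h : LArc ν p a d v g) (hν : 1 ≤ ν) (hp : 0 ≤ p) : (a/d) ^ ν ≤ d ^ 2 := by
  have ha := h.ha
  have hd := h.ha.trans h.had
  have hν0 : (1:ℝ) ≤ ν := by exact_mod_cast hν
  rw [div_pow, div_le_iff₀ (by positivity), ← pow_add]
  calc a ^ ν ≤ ν * a ^ ν := le_mul_of_one_le_left (by positivity) hν0
    _ ≤ g a := h.x_ge hν
    _ ≤ _ := h.ga_le hp
    _ ≤ d ^ (ν+2) := div_le_self (by positivity) (by linarith)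
    _ = _ := by ring

lemma ga_ge (h : LArc ν p a d v g) (hν : 1 ≤ ν) (hp : 1 ≤ p) :
    1 - d ^ 2 - p * (((ν:ℝ)+2) / 2 * d ^ 2 + d ^ 2) ≤ (ν+2) * g a / d ^ (ν+2) := by
  have ha := h.ha
  have hd := h.ha.trans h.had
  have hν0 : (1:ℝ) ≤ ν := by exact_mod_cast hν
  have := anti_aux (f := fun r => g r + r ^ (ν+2) / ((ν:ℝ)+2) -
      p * (a ^ ν * r ^ 2 / 2 + r ^ (ν+4) / (2 * (ν+2) * (ν+4))))
    (f' := fun r => -(v r ^ p * r ^ (ν+1)) + r ^ (ν+1) -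
      p * (a ^ ν * r + r ^ (ν+3) / (2 * (ν+2)))) (a := a) (b := d)
    ((h.cg.add (by fun_prop)).sub (by fun_prop)) ?_ ?_ le_rfl h.had.le le_rfl
  · simp only [h.gd, zero_add] at this
    have h1 : 0 ≤ p * (a ^ ν * a ^ 2 / 2 + a ^ (ν+4) / (2 * (ν+2) * (ν+4))) := by positivity
    have h2 : (d ^ (ν+2) - a ^ (ν+2)) / (ν+2) -
        p * (a ^ ν * d ^ 2 / 2 + d ^ (ν+4) / (2 * (ν+2) * (ν+4))) ≤ g a := by
      rw [sub_div]; linarith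
    have h3 := h.ad_le hν (by linarith)
    have h4 : (a/d)^(ν+2) ≤ (a/d)^ν :=
      pow_le_pow_of_le_one (by positivity) (by rw [div_le_one hd]; exact h.had.le) (by omega)
    have e : (ν+2) * ((d ^ (ν+2) - a ^ (ν+2)) / (ν+2) -
        p * (a ^ ν * d ^ 2 / 2 + d ^ (ν+4) / (2 * (ν+2) * (ν+4)))) / d ^ (ν+2) =
        1 - (a/d)^(ν+2) - p * (((ν:ℝ)+2) / 2 * (a/d) ^ ν + d^2 / (2 * (ν+4))) := by
      rw [div_pow, div_pow]; field_simp; ring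
    calc _ ≤ 1 - (a/d)^(ν+2) - p * (((ν:ℝ)+2) / 2 * (a/d) ^ ν + d^2 / (2 * (ν+4))) := by
          have : d^2 / (2 * ((ν:ℝ)+4)) ≤ d^2 := div_le_self (by positivity) (by linarith)
          have h5 : (a/d)^(ν+2) ≤ d^2 := h4.trans h3
          gcongr
      _ ≤ _ := by rw [← e]; gcongr
  · intro r hr
    refine (((h.dg r hr).add ((hasDerivAt_pow (ν+2) r).div_const ((ν:ℝ)+2))).sub
      (((((hasDerivAt_pow 2 r).const_mul (a^ν)).div_const 2).add
        ((hasDerivAt_pow (ν+4) r).div_const (2 * ((ν:ℝ)+2) * (ν+4)))).const_mul p)).congr_deriv ?_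
    push_cast; simp; field_simp
  · intro r hr
    have hr0 := h.ha.trans hr.1
    have h1 := h.v_ge hν (by linarith) hr.1.le hr.2.le
    have h2 : 1 ≤ g a / (ν * a ^ ν) := by
      rw [le_div_iff₀ (by positivity), one_mul]; exact h.x_ge hν
    have h3 : (a/r)^ν ≤ 1 := pow_le_one₀ (by positivity) (by rw [div_le_one hr0]; exact hr.1.le)
    have h4 : 1 - (a/r)^ν - r ^ 2 / (2 * ((ν:ℝ)+2)) ≤ v r := by nlinarith
    have h5 := one_add_mul_self_le_rpow_one_add (s := v r - 1) (by linarith [h.pos r hr]) hp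
    have h6 : 1 - p * ((a/r)^ν + r ^ 2 / (2 * ((ν:ℝ)+2))) ≤ v r ^ p := by
      rw [add_sub_cancel] at h5
      refine le_trans ?_ h5
      nlinarith
    have h7 : (1 - p * ((a/r)^ν + r ^ 2 / (2 * ((ν:ℝ)+2)))) * r ^ (ν+1) ≤ v r ^ p * r ^ (ν+1) := by
      gcongr
    have e : (1 - p * ((a/r)^ν + r ^ 2 / (2 * ((ν:ℝ)+2)))) * r ^ (ν+1) =
      r ^ (ν+1) - p * (a ^ ν * r + r ^ (ν+3) / (2 * (ν+2))) := by
      rw [div_pow]; field_simp; ring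
    linarith
end LArc

/-- the exponent, in terms of `ν = n - 2` -/
def pp (ν : ℕ) (ε : ℝ) : ℝ := ((ν:ℝ)+4)/ν - ε

lemma pp_ev {ν : ℕ} (hν : 1 ≤ ν) : ∀ᶠ ε in 𝓝[>] (0:ℝ), 0 < ε ∧ ((ν:ℝ)+3)/ν ≤ pp ν ε ∧ 1 ≤ pp ν ε ∧
    pp ν ε * ν ≤ ν + 4 ∧ pp ν ε ≤ ((ν:ℝ)+4)/ν := by
  have hν0 : (0:ℝ) < ν := by positivity
  have h1 : Ioo (0:ℝ) (1/ν) ∈ 𝓝[>] (0:ℝ) := Ioo_mem_nhdsGT (by positivity)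
  filter_upwards [h1] with ε hε
  have e : pp ν ε = ((ν:ℝ)+3)/ν + (1/ν - ε) := by unfold pp; field_simp; ring
  have e2 : ((ν:ℝ)+3)/ν = 1 + 3/ν := by field_simp
  have : 0 < (3:ℝ)/ν := by positivity
  refine ⟨hε.1, by linarith [hε.2], by linarith [hε.2], ?_, ?_⟩
  · unfold pp; rw [sub_mul, div_mul_cancel₀ _ hν0.ne']
    nlinarith [hε.1]
  · unfold pp; linarith [hε.1]

lemma pp_lim (ν : ℕ) : Tendsto (pp ν) (𝓝[>] (0:ℝ)) (𝓝 (((ν:ℝ)+4)/ν)) := by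
  have : Tendsto (pp ν) (𝓝 (0:ℝ)) (𝓝 (((ν:ℝ)+4)/ν - 0)) := tendsto_const_nhds.sub tendsto_id
  rw [sub_zero] at this
  exact this.mono_left nhdsWithin_le_nhds

namespace RArc
variable {ν : ℕ} {d b : ℝ → ℝ} {v g : ℝ → ℝ → ℝ}

lemma K_exists (hν : 1 ≤ ν)
    (hR : ∀ᶠ ε in 𝓝[>] (0:ℝ), RArc ν (pp ν ε) (d ε) (b ε) (v ε) (g ε))
    (hd0 : Tendsto d (𝓝[>] (0:ℝ)) (𝓝 0)) :
    ∃ K : ℝ → ℝ, Tendsto K (𝓝[>] (0:ℝ)) (𝓝 1) ∧ ∀ᶠ ε in 𝓝[>] (0:ℝ), 0 ≤ K ε ∧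
      ∀ r, d ε ≤ r → r ≤ b ε → v ε r ≤ K ε * U ν r := by
  have hε : Tendsto (fun ε : ℝ => ε) (𝓝[>] (0:ℝ)) (𝓝 0) := tendsto_id.mono_left nhdsWithin_le_nhds
  set τ : ℝ → ℝ := fun ε => √(d ε) + ε with hτ
  have hs : Tendsto (fun ε => √(d ε)) (𝓝[>] (0:ℝ)) (𝓝 0) := by
    have := (Real.continuous_sqrt.tendsto 0).comp hd0
    rw [Real.sqrt_zero] at this
    exact this
  have hτ0 : Tendsto τ (𝓝[>] (0:ℝ)) (𝓝 0) := by simpa using hs.add hε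
  have hq : Tendsto (fun ε => d ε / τ ε) (𝓝[>] (0:ℝ)) (𝓝 0) := by
    apply squeeze_zero' _ _ hs
    · filter_upwards [hR, pp_ev hν] with ε h1 h2
      have := h1.hd; have := h2.1
      positivity
    · filter_upwards [hR, pp_ev hν] with ε h1 h2
      have h3 := Real.sqrt_nonneg (d ε)
      rw [div_le_iff₀ (by have := h2.1; positivity)]
      nlinarith [Real.mul_self_sqrt h1.hd, h2.1]
  have hT : Tendsto (fun ε => tht ν (pp ν ε) (d ε) (τ ε)) (𝓝[>] (0:ℝ)) (𝓝 1) := by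
    have e1 : Tendsto (fun ε => 1 - τ ε ^ 2 / (2 * ((ν:ℝ)+2))) (𝓝[>] (0:ℝ)) (𝓝 1) := by
      simpa using ((hτ0.pow 2).div_const (2 * ((ν:ℝ)+2))).const_sub 1
    have e2 := e1.rpow (pp_lim ν) (Or.inl one_ne_zero)
    have e3 : Tendsto (fun ε => 1 - (d ε / τ ε) ^ (ν+2)) (𝓝[>] (0:ℝ)) (𝓝 1) := by
      simpa using (hq.pow (ν+2)).const_sub 1
    have e4 : Tendsto (fun ε => 1 - τ ε ^ 2) (𝓝[>] (0:ℝ)) (𝓝 1) := by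
      simpa using (hτ0.pow 2).const_sub 1
    simpa [tht] using (e2.mul e3).mul e4
  refine ⟨fun ε => tht ν (pp ν ε) (d ε) (τ ε) ^ (-((ν:ℝ)/2)), ?_, ?_⟩
  · simpa using hT.rpow_const (p := -((ν:ℝ)/2)) (Or.inl one_ne_zero)
  · filter_upwards [hR, pp_ev hν, hT.eventually_const_lt one_pos, hτ0.eventually_lt_const one_pos,
      hd0.eventually_lt_const one_pos] with ε h1 h2 h3 h4 h5
    refine ⟨(Real.rpow_pos_of_pos h3 _).le, ?_⟩
    intro r h6 h7
    refine h1.v_le' hν (by linarith [h2.2.2.1]) h2.2.2.2.1 ?_ h4 h3 h6 h7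
    have : d ε ≤ √(d ε) := by
      have h8 := Real.sqrt_nonneg (d ε)
      have h9 := Real.mul_self_sqrt h1.hd
      have : √(d ε) ≤ 1 := Real.sqrt_le_one.mpr h5.le
      nlinarith
    simp only [hτ]; linarith [h2.1]

lemma v_lim (hν : 1 ≤ ν)
    (hR : ∀ᶠ ε in 𝓝[>] (0:ℝ), RArc ν (pp ν ε) (d ε) (b ε) (v ε) (g ε))
    (hd0 : Tendsto d (𝓝[>] (0:ℝ)) (𝓝 0)) {r : ℝ} (hr : 0 < r) :
    (∀ᶠ ε in 𝓝[>] (0:ℝ), d ε < r ∧ r < b ε) ∧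
      Tendsto (fun ε => v ε r) (𝓝[>] (0:ℝ)) (𝓝 (U ν r)) := by
  obtain ⟨K, hK, hK'⟩ := K_exists hν hR hd0
  set M : ℝ → ℝ := fun ε => K ε ^ (pp ν ε) * U ν r ^ (pp ν ε - ((ν:ℝ)+4)/ν) with hM
  have hM1 : Tendsto M (𝓝[>] (0:ℝ)) (𝓝 1) := by
    have e1 := hK.rpow (pp_lim ν) (Or.inl one_ne_zero)
    have e2 : Tendsto (fun ε => U ν r ^ (pp ν ε - ((ν:ℝ)+4)/ν)) (𝓝[>] (0:ℝ)) (𝓝 1) := by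
      have := (tendsto_const_nhds (x := U ν r)).rpow ((pp_lim ν).sub_const (((ν:ℝ)+4)/ν))
        (Or.inl (U_pos ν r).ne')
      simpa using this
    simpa using e1.mul e2
  have hMU : Tendsto (fun ε => 1 - M ε + M ε * U ν r) (𝓝[>] (0:ℝ)) (𝓝 (U ν r)) := by
    simpa using (hM1.const_sub 1).add (hM1.mul_const (U ν r))
  have key : ∀ᶠ ε in 𝓝[>] (0:ℝ), ∀ s, d ε ≤ s → s ≤ b ε → s ≤ r → 1 - M ε + M ε * U ν s ≤ v ε s := by
    filter_upwards [hR, pp_ev hν, hK'] with ε h1 h2 h3 s h4 h5 h6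
    exact h1.v_ge_U hν (by linarith [h2.2.2.1])
      (mul_nonneg (Real.rpow_nonneg h3.1 _) (Real.rpow_nonneg (U_pos ν r).le _)) h3.2 le_rfl h3.1
      h2.2.2.2.2 h4 h5 h6
  have hdb : ∀ᶠ ε in 𝓝[>] (0:ℝ), d ε < r ∧ r < b ε := by
    filter_upwards [hR, key, hd0.eventually_lt_const hr, hMU.eventually_const_lt (U_pos ν r),
      hM1.eventually_const_lt one_pos] with ε h1 h2 h3 h4 h5
    refine ⟨h3, ?_⟩
    by_contra hb
    rw [not_lt] at hb
    have := h2 (b ε) h1.hdb.le le_rfl hb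
    rw [h1.vb] at this
    have h6 := U_anti ν (h1.hd.trans h1.hdb.le) hb
    nlinarith
  refine ⟨hdb, ?_⟩
  apply tendsto_of_tendsto_of_tendsto_of_le_of_le' hMU (by simpa using hK.mul_const (U ν r))
  · filter_upwards [key, hdb] with ε h1 h2
    exact h1 r h2.1.le h2.2.le le_rfl
  · filter_upwards [hK', hdb] with ε h1 h2
    exact h1.2 r h2.1.le h2.2.le

lemma U_bound (hν : 1 ≤ ν) (r : ℝ) (hr : 0 ≤ r) :
    U ν r ^ (((ν:ℝ)+3)/ν) * r ^ (ν+1) ≤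
      (((ν:ℝ)+2)*ν) ^ ((ν+1)) * ((((ν:ℝ)+2)*ν) * (1 + r^2)⁻¹) := by
  have hν1 : (1:ℝ) ≤ ν := by exact_mod_cast hν
  have hν0 : (0:ℝ) < ν := by positivity
  have hb := U_base ν r
  have hN : 1 ≤ ((ν:ℝ)+2)*ν := by nlinarith
  set N := ((ν:ℝ)+2)*ν with hNdef
  set y := 1 + r^2/N with hy
  have e : U ν r ^ (((ν:ℝ)+3)/ν) = (√y ^ (ν+1))⁻¹ * y⁻¹ := by
    unfold U
    rw [← Real.rpow_mul (by linarith)]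
    have : -((ν:ℝ)/2) * (((ν:ℝ)+3)/ν) = -(((ν+1:ℕ):ℝ)/2) + -1 := by push_cast; field_simp; ring
    rw [this, Real.rpow_add (by linarith), Real.rpow_neg_one, Real.rpow_neg (by linarith),
      Real.sqrt_eq_rpow, ← Real.rpow_natCast (y ^ ((1:ℝ)/2)), ← Real.rpow_mul (by linarith)]
    congr 3; ring
  rw [e]
  have hy0 : 0 < √y := Real.sqrt_pos.mpr (by linarith)
  have h1 : r ≤ N * √y := by
    have : r ^ 2 ≤ (N * √y)^2 := by
      rw [mul_pow, Real.sq_sqrt (by linarith), hy]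
      have : N^2 * (1 + r^2/N) = N^2 + N * r^2 := by field_simp
      rw [this]; nlinarith [sq_nonneg r]
    exact le_of_sq_le_sq this (by positivity)
  have h2 : r ^ (ν+1) ≤ N^(ν+1) * √y^(ν+1) := by rw [← mul_pow]; gcongr
  have h3 : y⁻¹ ≤ N * (1 + r^2)⁻¹ := by
    rw [inv_le_iff_one_le_mul₀ (by linarith), hy]
    have : N * (1+r^2)⁻¹ * (1 + r^2/N) = (N + r^2) / (1+r^2) := by field_simp
    rw [this, one_le_div (by positivity)]; linarith
  calc (√y ^ (ν+1))⁻¹ * y⁻¹ * r ^ (ν+1) = (r ^ (ν+1) * (√y ^ (ν+1))⁻¹) * y⁻¹ := by ring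
    _ ≤ ((N^(ν+1) * √y^(ν+1)) * (√y ^ (ν+1))⁻¹) * (N * (1 + r^2)⁻¹) := by
      gcongr
    _ = _ := by field_simp

lemma int_lim (hν : 1 ≤ ν)
    (hR : ∀ᶠ ε in 𝓝[>] (0:ℝ), RArc ν (pp ν ε) (d ε) (b ε) (v ε) (g ε))
    (hd0 : Tendsto d (𝓝[>] (0:ℝ)) (𝓝 0)) {w : ℝ → ℝ} {w0 : ℝ}
    (hw : Tendsto w (𝓝[>] (0:ℝ)) (𝓝 w0))
    (hw1 : ∀ᶠ ε in 𝓝[>] (0:ℝ), ((ν:ℝ)+3)/ν ≤ w ε) :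
    Tendsto (fun ε => ∫ r in (d ε)..(b ε), v ε r ^ w ε * r ^ (ν+1)) (𝓝[>] (0:ℝ))
      (𝓝 (∫ r in Ioi (0:ℝ), U ν r ^ w0 * r ^ (ν+1))) := by
  obtain ⟨K, hK, hK'⟩ := K_exists hν hR hd0
  have hν0 : (0:ℝ) < ν := by positivity
  have e1 : ∀ᶠ ε in 𝓝[>] (0:ℝ), (∫ r in Ioi (0:ℝ), (Ioc (d ε) (b ε)).indicator
      (fun r => v ε r ^ w ε * r ^ (ν+1)) r) = ∫ r in (d ε)..(b ε), v ε r ^ w ε * r ^ (ν+1) := by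
    filter_upwards [hR] with ε h1
    rw [intervalIntegral.integral_of_le h1.hdb.le, setIntegral_indicator measurableSet_Ioc]
    congr 2
    rw [Set.inter_eq_right]
    intro x hx; exact h1.hd.trans_lt hx.1
  refine Tendsto.congr' e1 ?_
  apply tendsto_integral_filter_of_dominated_convergence (μ := volume.restrict (Ioi (0:ℝ)))
    (fun r => (2:ℝ) ^ (((ν:ℝ)+3)/ν) * ((((ν:ℝ)+2)*ν) ^ ((ν+1)) * ((((ν:ℝ)+2)*ν) * (1 + r^2)⁻¹)))
  · filter_upwards [hR, hw1] with ε h1 h2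
    refine AEStronglyMeasurable.restrict ?_
    rw [aestronglyMeasurable_indicator_iff measurableSet_Ioc]
    refine ContinuousOn.aestronglyMeasurable ?_ measurableSet_Ioc
    have hpos : 0 ≤ w ε := le_trans (by positivity) h2
    have hc : ContinuousOn (fun r : ℝ => r ^ (ν+1)) (Icc (d ε) (b ε)) := by fun_prop
    exact ((h1.cv.rpow_const (fun _ _ => Or.inr hpos)).mul hc).mono Ioc_subset_Icc_self
  · filter_upwards [hR, hK', hK.eventually_lt_const one_lt_two, hw1] with ε h1 h2 h3 h4
    filter_upwards [ae_restrict_mem measurableSet_Ioi] with r hr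
    have hr0 : (0:ℝ) < r := hr
    by_cases hm : r ∈ Ioc (d ε) (b ε)
    · rw [indicator_of_mem hm]
      have hv0 := h1.v_nonneg hm.1.le hm.2
      have hv1 := h1.v_le_one hm.1.le hm.2
      have hv2 : v ε r ≤ 2 * U ν r := (h2.2 r hm.1.le hm.2).trans (by
        have := U_pos ν r; gcongr)
      rw [Real.norm_of_nonneg (mul_nonneg (Real.rpow_nonneg hv0 _) (by positivity))]
      refine le_trans ?_ (mul_le_mul_of_nonneg_left (U_bound hν r hr0.le) (by positivity))
      rw [← mul_assoc, ← Real.mul_rpow (by norm_num) (U_pos ν r).le]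
      gcongr
      calc v ε r ^ w ε ≤ v ε r ^ (((ν:ℝ)+3)/ν) :=
            Real.rpow_le_rpow_of_exponent_ge_of_imp hv0 hv1 h4 (by
              intro _ h; exfalso; have : 0 < ((ν:ℝ)+3)/ν := by positivity
              linarith)
        _ ≤ _ := Real.rpow_le_rpow hv0 hv2 (by positivity)
    · rw [indicator_of_notMem hm]; simp; positivity
  · exact (((integrable_inv_one_add_sq.const_mul _).const_mul _).const_mul _).restrict
  · filter_upwards [ae_restrict_mem measurableSet_Ioi] with r hr
    have hr0 : (0:ℝ) < r := hr
    obtain ⟨h1, h2⟩ := v_lim hν hR hd0 hr0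
    have := (h2.rpow hw (Or.inl (U_pos ν r).ne')).mul_const (r^(ν+1))
    refine this.congr' ?_
    filter_upwards [h1] with ε h
    rw [indicator_of_mem (show r ∈ Ioc (d ε) (b ε) from ⟨h.1, h.2.le⟩)]

end RArc

namespace RArc
variable {ν : ℕ}

lemma gU_lim (hν : 1 ≤ ν) : Tendsto (fun r => - gU ν r) atTop
    (𝓝 ((((ν:ℝ)+2)*ν) ^ (((ν:ℝ)+2)/2) / (ν+2))) := by
  have hν0 : (0:ℝ) < ν := by positivity
  have hN : 0 < ((ν:ℝ)+2)*ν := by positivity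
  have h1 : Tendsto (fun r : ℝ => ((r^2)⁻¹ + (((ν:ℝ)+2)*ν)⁻¹)) atTop (𝓝 (0 + (((ν:ℝ)+2)*ν)⁻¹)) :=
    ((tendsto_pow_atTop (by norm_num)).inv_tendsto_atTop).add_const _
  rw [zero_add] at h1
  have h2 := (h1.rpow_const (p := -(((ν:ℝ)+2)/2)) (Or.inl (by positivity))).div_const ((ν:ℝ)+2)
  rw [Real.inv_rpow hN.le, ← Real.rpow_neg hN.le, neg_neg] at h2
  refine h2.congr' ?_
  filter_upwards [eventually_gt_atTop 0] with r hr
  unfold gU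
  have hb := U_base ν r
  have e : (r^2)⁻¹ + (((ν:ℝ)+2)*ν)⁻¹ = (r^2)⁻¹ * (1 + r ^ 2 / (((ν:ℝ)+2)*ν)) := by field_simp
  rw [e, Real.mul_rpow (by positivity) (by linarith), neg_neg, Real.inv_rpow (by positivity),
    ← Real.rpow_neg (by positivity), neg_neg]
  have e2 : (r^2) ^ (((ν:ℝ)+2)/2) = r ^ (ν+2) := by
    rw [← Real.rpow_natCast, ← Real.rpow_natCast, ← Real.rpow_mul hr.le]
    congr 1; push_cast; ring
  rw [e2]
  have e3 : -(((ν:ℝ)+2)/2) = -((ν:ℝ)/2) - 1 := by ring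
  rw [e3]; ring

lemma C_val (hν : 1 ≤ ν) : ∫ r in Ioi (0:ℝ), U ν r ^ (((ν:ℝ)+4)/ν) * r ^ (ν+1) =
    (((ν:ℝ)+2)*ν) ^ (((ν:ℝ)+2)/2) / (ν+2) := by
  have := integral_Ioi_of_hasDerivAt_of_nonneg (g := fun r => - gU ν r) (a := 0)
    (g' := fun r => U ν r ^ (((ν:ℝ)+4)/ν) * r ^ (ν+1)) (gU_cont ν).neg.continuousWithinAt
    (fun r hr => (gU_deriv hν hr).neg.congr_deriv (by simp)) ?_ (gU_lim hν)
  · rw [this]; simp [gU]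
  · intro r hr
    have hr0 : (0:ℝ) < r := hr
    have := (Real.rpow_pos_of_pos (U_pos ν r) (((ν:ℝ)+4)/ν))
    positivity

lemma beta_real {a : ℝ} (ha : 0 < a) : ∫ x in Ioo (0:ℝ) 1, x ^ (a-1) * (1-x) ^ (a-1) =
    Real.Gamma a ^ 2 / Real.Gamma (2*a) := by
  have h1 := ProbabilityTheory.beta_eq_betaIntegralReal a a ha ha
  have h2 : Complex.betaIntegral a a = ((∫ x in (0:ℝ)..1, x ^ (a-1) * (1-x) ^ (a-1) : ℝ) : ℂ) := by
    unfold Complex.betaIntegral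
    rw [← intervalIntegral.integral_ofReal]
    apply intervalIntegral.integral_congr
    intro x hx
    rw [uIcc_of_le zero_le_one] at hx
    simp only
    push_cast
    rw [Complex.ofReal_cpow hx.1, Complex.ofReal_cpow (by linarith [hx.2])]
    push_cast
    rfl
  rw [h2, Complex.ofReal_re, intervalIntegral.integral_of_le zero_le_one,
    integral_Ioc_eq_integral_Ioo] at h1
  rw [← h1, ProbabilityTheory.beta, two_mul, sq]

lemma S_val (hν : 1 ≤ ν) : ∫ r in Ioi (0:ℝ), U ν r ^ (((ν:ℝ)+4)/ν + 1) * r ^ (ν+1) =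
    (((ν:ℝ)+2)*ν) ^ (((ν:ℝ)+2)/2) / 2 * (Real.Gamma (((ν:ℝ)+2)/2) ^ 2 / Real.Gamma ((ν:ℝ)+2)) := by
  have hν0 : (0:ℝ) < ν := by positivity
  set N := ((ν:ℝ)+2)*ν with hNd
  have hN : 0 < N := by positivity
  have hb := beta_real (a := ((ν:ℝ)+2)/2) (by positivity)
  rw [mul_div_cancel₀ _ (two_ne_zero)] at hb
  rw [← hb]
  set φ : ℝ → ℝ := fun r => r^2 / (N + r^2) with hφ
  have him : φ '' Ioi 0 = Ioo 0 1 := by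
    ext y
    constructor
    · rintro ⟨r, hr, rfl⟩
      have hr0 : (0:ℝ) < r := hr
      refine ⟨by simp only [hφ]; positivity, ?_⟩
      simp only [hφ]
      rw [div_lt_one (by positivity)]; linarith
    · rintro ⟨h0, h1⟩
      have h3 : 0 < 1 - y := by linarith
      refine ⟨√(N * y / (1-y)), Real.sqrt_pos.mpr (by positivity), ?_⟩
      simp only [hφ]
      rw [Real.sq_sqrt (by positivity)]
      field_simp
      ring
  have hinj : InjOn φ (Ioi 0) := by
    intro x hx y hy hxy
    have hx0 : (0:ℝ) < x := hx
    have hy0 : (0:ℝ) < y := hy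
    simp only [hφ] at hxy
    rw [div_eq_div_iff (by positivity) (by positivity)] at hxy
    have : x^2 = y^2 := by
      have : N * (x^2 - y^2) = 0 := by linarith
      rcases mul_eq_zero.mp this with h | h
      · exact absurd h hN.ne'
      · linarith
    exact (sq_eq_sq₀ hx0.le hy0.le).mp this
  rw [← him, integral_image_eq_integral_abs_deriv_smul measurableSet_Ioi
    (f' := fun r => 2 * r * N / (N + r^2)^2) ?_ hinj, ← integral_const_mul]
  · apply setIntegral_congr_fun measurableSet_Ioi
    intro r hr
    have hr0 : (0:ℝ) < r := hr
    simp only [hφ, smul_eq_mul]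
    rw [abs_of_pos (by positivity), ← Real.mul_rpow (by positivity)
      (by rw [sub_nonneg, div_le_one (by positivity)]; linarith)]
    have e1 : r^2/(N+r^2) * (1 - r^2/(N+r^2)) = r^2 * N / (N+r^2)^2 := by field_simp; ring
    rw [e1, Real.rpow_sub_one (by positivity), Real.div_rpow (by positivity) (by positivity),
      Real.mul_rpow (x := r^2) (y := N) (by positivity) (by positivity)]
    have e2 : (r^2) ^ (((ν:ℝ)+2)/2) = r ^ (ν+2) := by
      rw [← Real.rpow_natCast, ← Real.rpow_natCast, ← Real.rpow_mul hr0.le]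
      congr 1; push_cast; ring
    have e3 : ((N+r^2)^2) ^ (((ν:ℝ)+2)/2) = (N+r^2) ^ (ν+2) := by
      rw [← Real.rpow_natCast, ← Real.rpow_natCast (N+r^2), ← Real.rpow_mul (by positivity)]
      congr 1; push_cast; ring
    have e5 : N ^ (((ν:ℝ)+2)/2) * N ^ (((ν:ℝ)+2)/2) = N ^ (ν+2) := by
      rw [← Real.rpow_add hN, ← Real.rpow_natCast]; congr 1; push_cast; ring
    have e4 : U ν r ^ (((ν:ℝ)+4)/ν + 1) = N^(ν+2) / (N + r^2) ^ (ν+2) := by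
      unfold U
      rw [← Real.rpow_mul (by linarith [U_base ν r])]
      have : -((ν:ℝ)/2) * (((ν:ℝ)+4)/ν + 1) = -((ν+2:ℕ):ℝ) := by push_cast; field_simp; ring
      rw [this, Real.rpow_neg (by linarith [U_base ν r]), Real.rpow_natCast, ← hNd, ← div_pow,
        ← inv_pow]
      congr 1; field_simp
    rw [e2, e3, e4, ← e5]
    field_simp
    ring
  · intro r hr
    have hr0 : (0:ℝ) < r := hr
    have := ((hasDerivAt_pow 2 r).div ((hasDerivAt_pow 2 r).const_add N) (by positivity))
    refine (this.congr_deriv ?_).hasDerivWithinAt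
    field_simp
    push_cast
    ring

end RArc

/-- limiting flux -/
def Cc (ν : ℕ) : ℝ := (((ν:ℝ)+2)*ν) ^ (((ν:ℝ)+2)/2) / (ν+2)
/-- energy increment -/
def E0 (ν : ℕ) : ℝ := (ν:ℝ)^2/(4*(ν+2)) *
  ((((ν:ℝ)+2)*ν) ^ (((ν:ℝ)+2)/2) / 2 * (Real.Gamma (((ν:ℝ)+2)/2) ^ 2 / Real.Gamma ((ν:ℝ)+2)))

lemma Cc_pos {ν : ℕ} (hν : 1 ≤ ν) : 0 < Cc ν := by unfold Cc; positivity
lemma E0_pos {ν : ℕ} (hν : 1 ≤ ν) : 0 < E0 ν := by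
  unfold E0
  have h1 := Real.Gamma_pos_of_pos (s := ((ν:ℝ)+2)/2) (by positivity)
  have h2 := Real.Gamma_pos_of_pos (s := ((ν:ℝ)+2)) (by positivity)
  positivity

lemma c_lim {ν : ℕ} (hν : 1 ≤ ν) : Tendsto (fun ε => (((ν:ℝ)+2)/(pp ν ε+1) - ν/2)/ε) (𝓝[>] (0:ℝ))
    (𝓝 ((ν:ℝ)^2/(4*(ν+2)))) := by
  have hν0 : (0:ℝ) < ν := by positivity
  have h0 : Tendsto (fun ε => (ν:ℝ)/(2*(pp ν ε+1))) (𝓝[>] (0:ℝ))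
      (𝓝 ((ν:ℝ)/(2*(((ν:ℝ)+4)/ν+1)))) :=
    tendsto_const_nhds.div (((pp_lim ν).add_const 1).const_mul 2) (by positivity)
  have e : (ν:ℝ)/(2*(((ν:ℝ)+4)/ν+1)) = (ν:ℝ)^2/(4*(ν+2)) := by field_simp; ring
  rw [e] at h0
  refine h0.congr' ?_
  filter_upwards [pp_ev hν] with ε h
  have h1 : 0 < ε := h.1
  have h2 : 0 < pp ν ε + 1 := by linarith [h.2.2.1]
  have h3 : ν * pp ν ε = ν + 4 - ν * ε := by unfold pp; field_simp
  field_simp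
  linarith

namespace RArc
variable {ν : ℕ} {d b : ℝ → ℝ} {v g : ℝ → ℝ → ℝ}

lemma g_lim (hν : 1 ≤ ν)
    (hR : ∀ᶠ ε in 𝓝[>] (0:ℝ), RArc ν (pp ν ε) (d ε) (b ε) (v ε) (g ε))
    (hd0 : Tendsto d (𝓝[>] (0:ℝ)) (𝓝 0)) :
    Tendsto (fun ε => - g ε (b ε)) (𝓝[>] (0:ℝ)) (𝓝 (Cc ν)) := by
  have h1 := int_lim hν hR hd0 (pp_lim ν) ((pp_ev hν).mono fun ε h => h.2.1)
  rw [C_val hν] at h1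
  refine h1.congr' ?_
  filter_upwards [hR, pp_ev hν] with ε h2 h3
  exact (h2.flux (by linarith [h3.2.2.1])).symm

lemma e_lim (hν : 1 ≤ ν)
    (hR : ∀ᶠ ε in 𝓝[>] (0:ℝ), RArc ν (pp ν ε) (d ε) (b ε) (v ε) (g ε))
    (hd0 : Tendsto d (𝓝[>] (0:ℝ)) (𝓝 0)) {t : ℝ}
    (ht : Tendsto (fun ε => d ε ^ (ν+2) / (pp ν ε + 1) / ε) (𝓝[>] (0:ℝ)) (𝓝 t)) :
    Tendsto (fun ε => (g ε (b ε))^2 / b ε ^ ν / 2 / ε) (𝓝[>] (0:ℝ)) (𝓝 (t + E0 ν)) := by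
  have h1 := int_lim hν hR hd0 ((pp_lim ν).add_const 1)
    ((pp_ev hν).mono fun ε h => by linarith [h.2.1])
  rw [S_val hν] at h1
  refine (ht.add ((c_lim hν).mul h1)).congr' ?_
  filter_upwards [hR, pp_ev hν] with ε h2 h3
  rw [h2.poho hν (by linarith [h3.2.2.1])]
  ring

end RArc

lemma tendsto_id0 : Tendsto (fun ε : ℝ => ε) (𝓝[>] (0:ℝ)) (𝓝 0) :=
  tendsto_id.mono_left nhdsWithin_le_nhds

namespace LArc
variable {ν : ℕ} {a d : ℝ → ℝ} {v g : ℝ → ℝ → ℝ}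

lemma d_lim (hν : 1 ≤ ν)
    (hL : ∀ᶠ ε in 𝓝[>] (0:ℝ), LArc ν (pp ν ε) (a ε) (d ε) (v ε) (g ε)) {t : ℝ}
    (ht : Tendsto (fun ε => (g ε (a ε))^2 / a ε ^ ν / 2 / ε) (𝓝[>] (0:ℝ)) (𝓝 t)) :
    Tendsto d (𝓝[>] (0:ℝ)) (𝓝 0) := by
  have hν0 : (0:ℝ) < ν := by positivity
  have h1 : Tendsto (fun ε => (2 * (ν+2)) / (ν:ℝ) * ((g ε (a ε))^2 / a ε ^ ν / 2 / ε * ε)) (𝓝[>] (0:ℝ)) (𝓝 0) := by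
    simpa using (ht.mul tendsto_id0).const_mul ((2 * (ν+2)) / (ν:ℝ))
  have h2 : Tendsto (fun ε => d ε ^ (ν+2)) (𝓝[>] (0:ℝ)) (𝓝 0) := by
    refine squeeze_zero' ?_ ?_ h1
    · filter_upwards [hL] with ε h
      have := h.ha.trans h.had
      positivity
    · filter_upwards [hL, pp_ev hν] with ε h h3
      have := h.poho2 hν (by linarith [h3.2.2.1]) h3.2.2.2.1
      rw [div_mul_cancel₀ _ h3.1.ne']
      calc d ε ^ (ν+2) = (2 * (ν+2)) / (ν:ℝ) * ((ν:ℝ) / (2 * (ν+2)) * d ε ^ (ν+2)) := by field_simp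
        _ ≤ _ := by gcongr
  have h3 := h2.rpow_const (p := ((ν+2:ℕ):ℝ)⁻¹) (Or.inr (by positivity))
  rw [Real.zero_rpow (by positivity)] at h3
  refine h3.congr' ?_
  filter_upwards [hL] with ε h
  exact Real.pow_rpow_inv_natCast (h.ha.trans h.had).le (by positivity)

lemma dn_lim (hν : 1 ≤ ν)
    (hL : ∀ᶠ ε in 𝓝[>] (0:ℝ), LArc ν (pp ν ε) (a ε) (d ε) (v ε) (g ε)) {t : ℝ}
    (ht : Tendsto (fun ε => (g ε (a ε))^2 / a ε ^ ν / 2 / ε) (𝓝[>] (0:ℝ)) (𝓝 t)) :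
    Tendsto (fun ε => d ε ^ (ν+2) / (pp ν ε + 1) / ε) (𝓝[>] (0:ℝ)) (𝓝 t) := by
  have hν0 : (0:ℝ) < ν := by positivity
  have hd := d_lim hν hL ht
  have h2 := ht.add (((c_lim hν).div_const ((ν:ℝ)+2)).mul (hd.pow (ν+2)))
  rw [zero_pow (by positivity), mul_zero, add_zero] at h2
  refine tendsto_of_tendsto_of_tendsto_of_le_of_le' ht h2 ?_ ?_
  · filter_upwards [hL, pp_ev hν] with ε h h3
    have := h.poho1 hν (by linarith [h3.2.2.1]) h3.2.2.2.1
    have := h3.1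
    gcongr
  · filter_upwards [hL, pp_ev hν] with ε h h3
    have h4 := h.poho2 hν (by linarith [h3.2.2.1]) h3.2.2.2.1
    have h5 := h3.1
    have h6 : 0 < pp ν ε + 1 := by linarith [h3.2.2.1]
    calc d ε ^ (ν+2) / (pp ν ε + 1) / ε = (ν:ℝ) / (2 * (ν+2)) * d ε ^ (ν+2) / ε +
        (((ν:ℝ)+2)/(pp ν ε+1) - ν/2)/ε / (ν+2) * d ε ^ (ν+2) := by field_simp; ring
      _ ≤ _ := by gcongr

lemma x_lim (hν : 1 ≤ ν)
    (hL : ∀ᶠ ε in 𝓝[>] (0:ℝ), LArc ν (pp ν ε) (a ε) (d ε) (v ε) (g ε)) {t : ℝ}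
    (ht : Tendsto (fun ε => (g ε (a ε))^2 / a ε ^ ν / 2 / ε) (𝓝[>] (0:ℝ)) (𝓝 t)) :
    Tendsto (fun ε => g ε (a ε) / (ν * a ε ^ ν)) (𝓝[>] (0:ℝ)) (𝓝 1) := by
  have hν0 : (0:ℝ) < ν := by positivity
  have hd := d_lim hν hL ht
  have h1 : Tendsto (fun ε => (1 + d ε ^ 2 / (2 * ((ν:ℝ)+2))) / (1 - d ε ^ 2)) (𝓝[>] (0:ℝ)) (𝓝 1) := by
    have := (((hd.pow 2).div_const (2 * ((ν:ℝ)+2))).const_add 1).div ((hd.pow 2).const_sub 1)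
      (by norm_num)
    simpa [Pi.div_def] using this
  refine tendsto_of_tendsto_of_tendsto_of_le_of_le' tendsto_const_nhds h1 ?_ ?_
  · filter_upwards [hL, pp_ev hν] with ε h h3
    have := h.ha
    rw [one_le_div (by positivity)]
    exact h.x_ge hν
  · filter_upwards [hL, pp_ev hν, hd.eventually_lt_const one_pos] with ε h h3 h4
    have hp : 0 ≤ pp ν ε := by linarith [h3.2.2.1]
    have ha := h.ha
    have hd0 := ha.trans h.had
    have h5 := h.v_ge hν hp h.had.le le_rfl
    rw [h.vd] at h5
    have h6 := h.ad_le hν hp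
    have h7 : 1 ≤ g ε (a ε) / (ν * a ε ^ ν) := by
      rw [one_le_div (by positivity)]
      exact h.x_ge hν
    rw [le_div_iff₀ (by nlinarith)]
    nlinarith

lemma gd_lim (hν : 1 ≤ ν)
    (hL : ∀ᶠ ε in 𝓝[>] (0:ℝ), LArc ν (pp ν ε) (a ε) (d ε) (v ε) (g ε)) {t : ℝ}
    (ht : Tendsto (fun ε => (g ε (a ε))^2 / a ε ^ ν / 2 / ε) (𝓝[>] (0:ℝ)) (𝓝 t)) :
    Tendsto (fun ε => (ν+2) * g ε (a ε) / d ε ^ (ν+2)) (𝓝[>] (0:ℝ)) (𝓝 1) := by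
  have hν0 : (0:ℝ) < ν := by positivity
  have hd := d_lim hν hL ht
  have h1 : Tendsto (fun ε => 1 - d ε ^ 2 - pp ν ε * (((ν:ℝ)+2) / 2 * d ε ^ 2 + d ε ^ 2))
      (𝓝[>] (0:ℝ)) (𝓝 1) := by
    have := ((hd.pow 2).const_sub 1).sub ((pp_lim ν).mul
      (((hd.pow 2).const_mul (((ν:ℝ)+2)/2)).add (hd.pow 2)))
    simpa using this
  refine tendsto_of_tendsto_of_tendsto_of_le_of_le' h1 tendsto_const_nhds ?_ ?_
  · filter_upwards [hL, pp_ev hν] with ε h h3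
    exact h.ga_ge hν h3.2.2.1
  · filter_upwards [hL, pp_ev hν] with ε h h3
    have hd0 := h.ha.trans h.had
    have := h.ga_le (by linarith [h3.2.2.1])
    rw [div_le_one (by positivity)]
    rwa [le_div_iff₀' (by positivity)] at this

/-- ratio of consecutive heights: crude bound, and transfer of the energy -/
lemma link (hν : 1 ≤ ν)
    (hL : ∀ᶠ ε in 𝓝[>] (0:ℝ), LArc ν (pp ν ε) (a ε) (d ε) (v ε) (g ε))
    {b G A : ℝ → ℝ} {T : ℝ} (hT : 0 < T)
    (hb : ∀ᶠ ε in 𝓝[>] (0:ℝ), 0 < b ε) (hA : ∀ᶠ ε in 𝓝[>] (0:ℝ), 0 < A ε)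
    (ha : ∀ᶠ ε in 𝓝[>] (0:ℝ), a ε = b ε * A ε ^ (-((pp ν ε - 1)/2)))
    (hg : ∀ᶠ ε in 𝓝[>] (0:ℝ), g ε (a ε) = G ε * A ε ^ (1 - ν * ((pp ν ε - 1)/2)))
    (hG : Tendsto G (𝓝[>] (0:ℝ)) (𝓝 (Cc ν)))
    (he : Tendsto (fun ε => G ε^2 / b ε ^ ν / 2 / ε) (𝓝[>] (0:ℝ)) (𝓝 T)) :
    Tendsto (fun ε => ε * Real.log (A ε)) (𝓝[>] (0:ℝ)) (𝓝 0) ∧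
    Tendsto (fun ε => (g ε (a ε))^2 / a ε ^ ν / 2 / ε) (𝓝[>] (0:ℝ)) (𝓝 T) ∧
    (∀ᶠ ε in 𝓝[>] (0:ℝ), g ε (a ε) / (ν * a ε ^ ν) = A ε * G ε / (ν * b ε ^ ν)) := by
  have hν0 : (0:ℝ) < ν := by positivity
  have hC := Cc_pos hν
  have hx : ∀ᶠ ε in 𝓝[>] (0:ℝ), g ε (a ε) / (ν * a ε ^ ν) = A ε * G ε / (ν * b ε ^ ν) := by
    filter_upwards [hb, hA, ha, hg] with ε h1 h2 h3 h4
    rw [h4, h3, mul_pow, ← Real.rpow_natCast (A ε ^ _), ← Real.rpow_mul h2.le, Real.rpow_sub h2,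
      Real.rpow_one]
    have : -((pp ν ε - 1)/2) * (ν:ℝ) = - (ν * ((pp ν ε - 1)/2)) := by ring
    rw [this, Real.rpow_neg h2.le]
    have := Real.rpow_pos_of_pos h2 (ν * ((pp ν ε - 1)/2))
    field_simp
  -- size of b
  set c := Cc ν ^ 2 / (2 * T) with hc
  have hc0 : 0 < c := by positivity
  have hbε : Tendsto (fun ε => b ε ^ ν * ε) (𝓝[>] (0:ℝ)) (𝓝 c) := by
    have h1 := ((hG.pow 2).div_const 2).div he hT.ne'
    have e : Cc ν ^ 2 / 2 / T = c := by rw [hc]; field_simp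
    rw [e] at h1
    refine h1.congr' ?_
    filter_upwards [hb, pp_ev hν, hG.eventually_const_lt hC] with ε h1 h2 h3
    have := h2.1
    simp only [Pi.div_apply]
    field_simp
  have hbinf : Tendsto (fun ε => b ε ^ ν) (𝓝[>] (0:ℝ)) atTop := by
    have h1 := hbε.pos_mul_atTop hc0 (tendsto_inv_nhdsGT_zero (𝕜 := ℝ))
    refine h1.congr' ?_
    filter_upwards [pp_ev hν] with ε h2
    have := h2.1
    field_simp
  have hAge : ∀ᶠ ε in 𝓝[>] (0:ℝ), 1 ≤ A ε := by
    filter_upwards [hL, hx, hb, hbinf.eventually_ge_atTop ((Cc ν + 1)/ν),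
      hG.eventually_const_lt hC, hG.eventually_lt_const (lt_add_one _)] with ε h1 h2 h3 h4 h5 h6
    have h7 : 1 ≤ g ε (a ε) / (ν * a ε ^ ν) := by
      have := h1.ha
      rw [one_le_div (by positivity)]
      exact h1.x_ge hν
    rw [h2, one_le_div (by positivity)] at h7
    rw [div_le_iff₀ hν0] at h4
    by_contra h8
    rw [not_le] at h8
    nlinarith
  set L := (ν:ℝ) * 2 ^ (ν+2) * 2 * 2 / Cc ν * (c+1)^3 with hLdef
  have hL0 : 0 < L := by positivity
  have hAle : ∀ᶠ ε in 𝓝[>] (0:ℝ), A ε ≤ L * (ε^3)⁻¹ := by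
    filter_upwards [hL, hx, hb, hAge, ha, pp_ev hν, hbinf.eventually_ge_atTop 1,
      hG.eventually_const_lt (half_lt_self hC),
      hbε.eventually_lt_const (lt_add_one _)] with ε h1 h2 h3 h4 h5 h6 h7 h8 h9
    have hp := h6.2.2.1
    have hε := h6.1
    have h10 := h1.crude hν (by linarith)
    rw [h2] at h10
    have hG0 : 0 < G ε := by linarith
    have hab : a ε ≤ b ε := by
      rw [h5]
      have : A ε ^ (-((pp ν ε - 1)/2)) ≤ 1 :=
        Real.rpow_le_one_of_one_le_of_nonpos h4 (by linarith)
      nlinarith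
    have ha0 := h1.ha
    have hb1 : 1 ≤ b ε := by
      by_contra hlt
      rw [not_le] at hlt
      have := pow_lt_one₀ h3.le hlt (by omega : ν ≠ 0)
      linarith
    have hbb : b ε ≤ b ε ^ ν := le_self_pow₀ hb1 (by omega)
    set y := b ε ^ ν with hy
    have h11 : 1 + a ε ^ 2 ≤ 2 * y ^ 2 := by nlinarith
    rw [div_le_iff₀ (by positivity)] at h10
    have h12 : A ε * (Cc ν / 2) ≤ 2^(ν+2) * (2 * y^2) * (ν * y) :=
      calc A ε * (Cc ν / 2) ≤ A ε * G ε := by gcongr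
        _ ≤ 2 ^ (ν+2) * (1 + a ε ^ 2) * (ν * y) := h10
        _ ≤ _ := by gcongr
    have h13 : A ε ≤ (ν:ℝ) * 2 ^ (ν+2) * 2 * 2 / Cc ν * y^3 := by
      have : (ν:ℝ) * 2 ^ (ν+2) * 2 * 2 / Cc ν * y^3 =
        (2^(ν+2) * (2 * y^2) * (ν * y)) / (Cc ν / 2) := by field_simp
      rw [this, le_div_iff₀ (by positivity)]
      exact h12
    refine h13.trans ?_
    have h14 : y ≤ (c+1) * ε⁻¹ := by
      rw [← div_eq_mul_inv, le_div_iff₀ hε]; exact h9.le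
    calc (ν:ℝ) * 2 ^ (ν+2) * 2 * 2 / Cc ν * y^3
        ≤ (ν:ℝ) * 2 ^ (ν+2) * 2 * 2 / Cc ν * ((c+1) * ε⁻¹)^3 := by gcongr
      _ = _ := by rw [hLdef]; field_simp
  have hlog : Tendsto (fun ε => ε * Real.log (A ε)) (𝓝[>] (0:ℝ)) (𝓝 0) := by
    have h1 : Tendsto (fun ε : ℝ => ε * Real.log L - 3 * (Real.log ε * ε)) (𝓝[>] (0:ℝ)) (𝓝 0) := by
      have hll : Tendsto (fun x : ℝ => Real.log x * x) (𝓝[>] (0:ℝ)) (𝓝 0) := by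
        simpa using tendsto_log_mul_rpow_nhdsGT_zero one_pos
      have := (tendsto_id0.mul_const (Real.log L)).sub (hll.const_mul 3)
      simpa using this
    refine squeeze_zero' ?_ ?_ h1
    · filter_upwards [hAge, pp_ev hν] with ε h2 h3
      exact mul_nonneg h3.1.le (Real.log_nonneg h2)
    · filter_upwards [hAge, hAle, pp_ev hν] with ε h2 h3 h4
      have hε := h4.1
      have h5 := Real.log_le_log (by linarith) h3
      rw [Real.log_mul hL0.ne' (by positivity), Real.log_inv, Real.log_pow] at h5
      calc ε * Real.log (A ε) ≤ ε * (Real.log L + -((3:ℕ) * Real.log ε)) := by gcongr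
        _ = _ := by push_cast; ring
  refine ⟨hlog, ?_, hx⟩
  have h1 : Tendsto (fun ε => Real.exp (ν/2 * (ε * Real.log (A ε)))) (𝓝[>] (0:ℝ)) (𝓝 1) := by
    have := (Real.continuous_exp.tendsto _).comp (hlog.const_mul ((ν:ℝ)/2))
    simpa [Function.comp_def] using this
  have h2 := he.mul h1
  rw [mul_one] at h2
  refine h2.congr' ?_
  filter_upwards [hb, hA, ha, hg] with ε h1 h2 h3 h4
  have e1 : Real.exp (ν/2 * (ε * Real.log (A ε))) = A ε ^ (ν/2*ε) := by
    rw [Real.rpow_def_of_pos h2]; congr 1; ring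
  rw [e1, h4, h3, mul_pow, mul_pow, ← Real.rpow_natCast (A ε ^ _), ← Real.rpow_mul h2.le,
    ← Real.rpow_natCast (A ε ^ _), ← Real.rpow_mul h2.le]
  have e2 : A ε ^ (ν/2*ε) = A ε ^ ((1 - ν * ((pp ν ε - 1) / 2)) * ((2:ℕ):ℝ)) /
      A ε ^ (-((pp ν ε - 1) / 2) * (ν:ℝ)) := by
    rw [← Real.rpow_sub h2]
    congr 1
    unfold pp
    push_cast
    field_simp
    ring
  rw [e2]
  have := Real.rpow_pos_of_pos h2 (-((pp ν ε - 1) / 2) * (ν:ℝ))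
  field_simp

end LArc

lemma scale_deriv {ν : ℕ} {p α l s : ℝ} {w G : ℝ → ℝ} (hα : 0 < α) (hl : l = α ^ (-((p-1)/2)))
    (hs : 0 < s) (hw0 : 0 ≤ w (l*s)) (hw : HasDerivAt w (G (l*s) / (l*s) ^ (ν+1)) (l*s))
    (hG : HasDerivAt G (-(w (l*s) ^ p * (l*s) ^ (ν+1))) (l*s)) :
    HasDerivAt (fun s => w (l*s) / α) (G (l*s) / (α * l^ν) / s ^ (ν+1)) s ∧
    HasDerivAt (fun s => G (l*s) / (α * l^ν)) (-((w (l*s) / α) ^ p * s ^ (ν+1))) s := by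
  have hl0 : 0 < l := by rw [hl]; exact Real.rpow_pos_of_pos hα _
  have hm : HasDerivAt (fun s : ℝ => l * s) l s := by simpa using (hasDerivAt_id s).const_mul l
  constructor
  · refine ((hw.comp s hm).div_const α).congr_deriv ?_
    rw [mul_pow]
    field_simp
    ring
  · refine ((hG.comp s hm).div_const (α * l^ν)).congr_deriv ?_
    rw [mul_pow, Real.div_rpow hw0 hα.le]
    have e : l^2 * α ^ p = α := by
      rw [hl, ← Real.rpow_natCast, ← Real.rpow_mul hα.le, ← Real.rpow_add hα]
      conv_rhs => rw [← Real.rpow_one α]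
      congr 1; push_cast; ring
    have hαp := Real.rpow_pos_of_pos hα p
    have e' : α ^ p = α / l^2 := by field_simp; linarith
    rw [e']
    field_simp
    ring

lemma cont_scale {w : ℝ → ℝ} {x y l c : ℝ} (hl0 : 0 < l) (h : ContinuousOn w (Icc x y)) :
    ContinuousOn (fun s => w (l*s) / c) (Icc (x/l) (y/l)) := by
  apply ContinuousOn.div_const
  apply h.comp (by fun_prop)
  intro s hs
  have h1 := hs.1; have h2 := hs.2
  rw [div_le_iff₀ hl0] at h1
  rw [le_div_iff₀ hl0] at h2
  constructor <;> linarith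

lemma mem_scale {x y l s : ℝ} (hl0 : 0 < l) (hs : s ∈ Ioo (x/l) (y/l)) : l*s ∈ Ioo x y := by
  have h1 := hs.1; have h2 := hs.2
  rw [div_lt_iff₀ hl0] at h1
  rw [lt_div_iff₀ hl0] at h2
  constructor <;> linarith

lemma RArc.scale {ν : ℕ} {p α l δ ρ : ℝ} {w G : ℝ → ℝ} (hα : 0 < α) (hl : l = α ^ (-((p-1)/2)))
    (hδ : 0 ≤ δ) (hδρ : δ < ρ) (cw : ContinuousOn w (Icc δ ρ)) (cG : ContinuousOn G (Icc δ ρ))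
    (dw : ∀ r ∈ Ioo δ ρ, HasDerivAt w (G r / r ^ (ν+1)) r)
    (dG : ∀ r ∈ Ioo δ ρ, HasDerivAt G (-(w r ^ p * r ^ (ν+1))) r)
    (pos : ∀ r ∈ Ioo δ ρ, 0 < w r) (wd : w δ = α) (Gd : G δ = 0) (wb : w ρ = 0) :
    RArc ν p (δ/l) (ρ/l) (fun s => w (l*s) / α) (fun s => G (l*s) / (α * l^ν)) := by
  have hl0 : 0 < l := by rw [hl]; exact Real.rpow_pos_of_pos hα _
  have key : ∀ s ∈ Ioo (δ/l) (ρ/l), _ := fun s hs => scale_deriv (ν := ν) hα hl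
    (lt_of_le_of_lt (by positivity) hs.1) (pos _ (mem_scale hl0 hs)).le
    (dw _ (mem_scale hl0 hs)) (dG _ (mem_scale hl0 hs))
  refine ⟨by positivity, by gcongr, cont_scale hl0 cw, cont_scale hl0 cG, fun s hs => (key s hs).1,
    fun s hs => (key s hs).2, fun s hs => div_pos (pos _ (mem_scale hl0 hs)) hα, ?_, ?_, ?_⟩
  · simp only [mul_div_cancel₀ _ hl0.ne', wd, div_self hα.ne']
  · simp only [mul_div_cancel₀ _ hl0.ne', Gd, zero_div]
  · simp only [mul_div_cancel₀ _ hl0.ne', wb, zero_div]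

lemma LArc.scale {ν : ℕ} {p α l δ ρ : ℝ} {w G : ℝ → ℝ} (hα : 0 < α) (hl : l = α ^ (-((p-1)/2)))
    (hρ : 0 < ρ) (hδρ : ρ < δ) (cw : ContinuousOn w (Icc ρ δ)) (cG : ContinuousOn G (Icc ρ δ))
    (dw : ∀ r ∈ Ioo ρ δ, HasDerivAt w (G r / r ^ (ν+1)) r)
    (dG : ∀ r ∈ Ioo ρ δ, HasDerivAt G (-(w r ^ p * r ^ (ν+1))) r)
    (pos : ∀ r ∈ Ioo ρ δ, 0 < w r) (wd : w δ = α) (Gd : G δ = 0) (wb : w ρ = 0) :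
    LArc ν p (ρ/l) (δ/l) (fun s => w (l*s) / α) (fun s => G (l*s) / (α * l^ν)) := by
  have hl0 : 0 < l := by rw [hl]; exact Real.rpow_pos_of_pos hα _
  have key : ∀ s ∈ Ioo (ρ/l) (δ/l), _ := fun s hs => scale_deriv (ν := ν) hα hl
    (lt_of_le_of_lt (by positivity) hs.1) (pos _ (mem_scale hl0 hs)).le
    (dw _ (mem_scale hl0 hs)) (dG _ (mem_scale hl0 hs))
  refine ⟨by positivity, by gcongr, cont_scale hl0 cw, cont_scale hl0 cG, fun s hs => (key s hs).1,
    fun s hs => (key s hs).2, fun s hs => div_pos (pos _ (mem_scale hl0 hs)) hα, ?_, ?_, ?_⟩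
  · simp only [mul_div_cancel₀ _ hl0.ne', wb, zero_div]
  · simp only [mul_div_cancel₀ _ hl0.ne', wd, div_self hα.ne']
  · simp only [mul_div_cancel₀ _ hl0.ne', Gd, zero_div]

section data
variable {ν : ℕ} {p : ℝ} {m : ℕ} {u : ℝ → ℝ} {ρ δ : ℕ → ℝ}

lemma DD.rho_mem (h : DirichletData (ν+2) p m u ρ δ) {k : ℕ} (h1 : 1 ≤ k) (h2 : k ≤ m) :
    0 < ρ k ∧ ρ k ≤ 1 ∧ u (ρ k) = 0 := by
  obtain ⟨_, _, _, _, _, _, hz, _⟩ := h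
  have : ρ k ∈ ρ '' Set.Icc 1 m := ⟨k, ⟨h1, h2⟩, rfl⟩
  rw [← hz] at this
  exact ⟨this.1.1, this.1.2, this.2⟩

lemma DD.delta_mem (h : DirichletData (ν+2) p m u ρ δ) {k : ℕ} (h1 : 1 ≤ k) (h2 : k ≤ m) :
    0 ≤ δ k ∧ δ k ≤ 1 ∧ deriv u (δ k) = 0 := by
  obtain ⟨_, _, _, _, _, _, _, hz⟩ := h
  have : δ k ∈ δ '' Set.Icc 1 m := ⟨k, ⟨h1, h2⟩, rfl⟩
  rw [← hz] at this
  exact ⟨this.1.1, this.1.2, this.2⟩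

lemma DD.anti (h : DirichletData (ν+2) p m u ρ δ) {i j : ℕ} (h1 : 1 ≤ i) (h2 : i ≤ j)
    (h3 : j ≤ m) : ρ j ≤ ρ i := by
  obtain ⟨_, _, _, _, hd, hr, _, _⟩ := h
  induction j, h2 using Nat.le_induction with
  | base => exact le_rfl
  | succ j hj ih =>
    have := ih (by omega)
    have := hd j (by omega) (by omega)
    have := hr j (by omega) (by omega)
    linarith

lemma DD.deriv_one (h : DirichletData (ν+2) p m u ρ δ) : deriv u 1 ≠ 0 := by
  intro h0
  have h' := h
  obtain ⟨_, _, _, _, hd, hr, _, hz⟩ := h'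
  have : (1:ℝ) ∈ {r : ℝ | r ∈ Set.Icc (0 : ℝ) 1 ∧ deriv u r = 0} := ⟨by simp, h0⟩
  rw [hz] at this
  obtain ⟨k, hk, hk2⟩ := this
  have := hd k hk.1 hk.2
  have := (DD.rho_mem h hk.1 hk.2).2.1
  linarith

lemma DD.deriv_rho (h : DirichletData (ν+2) p m u ρ δ) {r : ℝ} (hr : r ∈ Ioo (0:ℝ) 1) :
    HasDerivAt u (deriv u r) r ∧ ContDiffAt ℝ 2 u r := by
  have hc : ContDiffAt ℝ 2 u r := h.1.1.contDiffAt (Icc_mem_nhds hr.1 hr.2)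
  exact ⟨(hc.differentiableAt (by norm_num)).hasDerivAt, hc⟩

/-- the flux -/
def fluxG (ν : ℕ) (u : ℝ → ℝ) (r : ℝ) : ℝ := r ^ (ν+1) * deriv u r

lemma DD.flux_deriv (h : DirichletData (ν+2) p m u ρ δ) {r : ℝ} (hr : r ∈ Ioo (0:ℝ) 1) :
    HasDerivAt (fluxG ν u) (-(|u r| ^ (p-1) * u r * r ^ (ν+1))) r := by
  have h1 := h.1.2.2 r ⟨hr.1, hr.2.le⟩
  have h2 := (DD.deriv_rho h hr).2
  have h3 : DifferentiableAt ℝ (deriv u) r := by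
    have : ContDiffAt ℝ 1 (deriv u) r := by
      exact ContDiffAt.derivWithin h2 (by norm_num)
    exact this.differentiableAt (by norm_num)
  have h4 : DifferentiableAt ℝ (fluxG ν u) r := by
    unfold fluxG; fun_prop
  have := h4.hasDerivAt
  refine this.congr_deriv ?_
  exact h1

lemma DD.flux_cont (h : DirichletData (ν+2) p m u ρ δ) : ContinuousOn (fluxG ν u) (Icc 0 1) := by
  have h1 : ContinuousOn (derivWithin u (Icc 0 1)) (Icc 0 1) :=
    h.1.1.continuousOn_derivWithin (uniqueDiffOn_Icc zero_lt_one) (by norm_num)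
  have h2 : ContinuousOn (fun r : ℝ => r ^ (ν+1) * derivWithin u (Icc 0 1) r) (Icc 0 1) :=
    (continuousOn_pow _).mul h1
  refine h2.congr ?_
  intro r hr
  unfold fluxG
  by_cases h0 : r = 0
  · simp [h0]
  simp only
  congr 1
  have hd : DifferentiableAt ℝ u r := by
    by_cases h1 : r = 1
    · rw [h1]; by_contra hc; exact DD.deriv_one h (deriv_zero_of_not_differentiableAt hc)
    · exact (DD.deriv_rho h ⟨lt_of_le_of_ne hr.1 (Ne.symm h0), lt_of_le_of_ne hr.2 h1⟩).1.differentiableAt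
  exact (hd.derivWithin (uniqueDiffOn_Icc zero_lt_one r hr)).symm

lemma DD.sign (h : DirichletData (ν+2) p m u ρ δ) {x y : ℝ} (hx : 0 ≤ x) (hy : y ≤ 1)
    (hxy : x < y) (hne : ∀ r ∈ Ioo x y, u r ≠ 0) :
    ∃ σ : ℝ, (σ = 1 ∨ σ = -1) ∧ ∀ r ∈ Ioo x y, 0 < σ * u r := by
  have hcu : ContinuousOn u (Icc 0 1) := h.1.1.continuousOn
  have hmid : (x+y)/2 ∈ Ioo x y := ⟨by linarith, by linarith⟩
  have key : ∀ σ : ℝ, σ ≠ 0 → 0 < σ * u ((x+y)/2) → ∀ r ∈ Ioo x y, 0 < σ * u r := by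
    intro σ hσ h0 r hr
    by_contra hc
    rw [not_lt] at hc
    have hsub : uIcc ((x+y)/2) r ⊆ Ioo x y := (Set.ordConnected_Ioo).uIcc_subset hmid hr
    have hcont : ContinuousOn (fun r => σ * u r) (uIcc ((x+y)/2) r) :=
      (hcu.mono (hsub.trans (fun z hz => ⟨hx.trans hz.1.le, hz.2.le.trans hy⟩))).const_smul σ
    have := intermediate_value_uIcc hcont (show (0:ℝ) ∈ uIcc _ _ from
      Set.mem_uIcc.mpr (Or.inr ⟨hc, h0.le⟩))
    obtain ⟨z, hz, hz2⟩ := this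
    rcases mul_eq_zero.mp hz2 with h5 | h5
    · exact hσ h5
    · exact hne z (hsub hz) h5
  rcases lt_or_gt_of_ne (hne _ hmid) with h1 | h1
  · exact ⟨-1, Or.inr rfl, key (-1) (by norm_num) (by linarith)⟩
  · exact ⟨1, Or.inl rfl, key 1 (by norm_num) (by linarith)⟩

lemma DD.nozero (h : DirichletData (ν+2) p m u ρ δ) {k : ℕ} (h1 : 1 ≤ k) (h2 : k ≤ m) :
    ∃ L : ℝ, 0 ≤ L ∧ L ≤ δ k ∧ (k < m → L = ρ (k+1) ∧ L < δ k) ∧ (k = m → L = 0 ∧ δ k = 0) ∧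
      ∀ r ∈ Ioo L (ρ k), u r ≠ 0 := by
  have h' := h
  obtain ⟨_, _, _, hdm, hd, hr, hz, _⟩ := h'
  have key : ∀ r ∈ Ioo (0:ℝ) (ρ k), u r = 0 → ∃ j, k + 1 ≤ j ∧ j ≤ m ∧ ρ j = r := by
    intro r hr0 hu0
    have hmem : r ∈ {r : ℝ | r ∈ Set.Ioc (0 : ℝ) 1 ∧ u r = 0} :=
      ⟨⟨hr0.1, hr0.2.le.trans (DD.rho_mem h h1 h2).2.1⟩, hu0⟩
    rw [hz] at hmem
    obtain ⟨j, hj, hj2⟩ := hmem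
    refine ⟨j, ?_, hj.2, hj2⟩
    by_contra hc
    have := DD.anti h hj.1 (show j ≤ k by omega) h2
    linarith [hr0.2]
  rcases h2.lt_or_eq with hk | hk
  · refine ⟨ρ (k+1), (DD.rho_mem h (by omega) (by omega)).1.le, (hr k h1 hk).le,
      fun _ => ⟨rfl, hr k h1 hk⟩, fun hc => absurd hc hk.ne, ?_⟩
    intro r hr2 hu0
    obtain ⟨j, hj1, hj2, hj3⟩ := key r
      ⟨(DD.rho_mem h (by omega : 1 ≤ k+1) (by omega)).1.trans hr2.1, hr2.2⟩ hu0
    have := DD.anti h (by omega : 1 ≤ k+1) hj1 hj2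
    linarith [hr2.1]
  · subst hk
    refine ⟨0, le_rfl, hdm.ge, fun hc => absurd hc (lt_irrefl _), fun _ => ⟨rfl, hdm⟩, ?_⟩
    intro r hr2 hu0
    obtain ⟨j, hj1, hj2, hj3⟩ := key r hr2 hu0
    omega

lemma DD.arcs (h : DirichletData (ν+2) p m u ρ δ) {k : ℕ} (h1 : 1 ≤ k) (h2 : k ≤ m) :
    0 < |u (δ k)| ∧ ∀ l : ℝ, l = |u (δ k)| ^ (-((p-1)/2)) → ∃ v g : ℝ → ℝ,
      RArc ν p (δ k / l) (ρ k / l) v g ∧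
      - g (ρ k / l) = |fluxG ν u (ρ k)| / (|u (δ k)| * l ^ ν) ∧
      (k < m → LArc ν p (ρ (k+1) / l) (δ k / l) v g ∧
        g (ρ (k+1) / l) = |fluxG ν u (ρ (k+1))| / (|u (δ k)| * l ^ ν)) := by
  obtain ⟨L, hL0, hLd, hLk, hLm, hne⟩ := DD.nozero h h1 h2
  have hdr : δ k < ρ k := h.2.2.2.2.1 k h1 h2
  obtain ⟨hρ0, hρ1, hρu⟩ := DD.rho_mem h h1 h2
  obtain ⟨hδ0, hδ1, hδu⟩ := DD.delta_mem h h1 h2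
  obtain ⟨σ, hσ, hpos⟩ := DD.sign h hL0 hρ1 (hLd.trans_lt hdr) hne
  have hcu : ContinuousOn u (Icc 0 1) := h.1.1.continuousOn
  have hσ0 : σ ≠ 0 := by rcases hσ with rfl | rfl <;> norm_num
  have habs : |σ| = 1 := by rcases hσ with rfl | rfl <;> norm_num
  set w : ℝ → ℝ := fun r => σ * u r with hw
  set G : ℝ → ℝ := fun r => σ * fluxG ν u r with hG
  have cw : ContinuousOn w (Icc 0 1) := continuousOn_const.mul hcu
  have cG : ContinuousOn G (Icc 0 1) := continuousOn_const.mul (DD.flux_cont h)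
  have dw : ∀ r ∈ Ioo L (ρ k), HasDerivAt w (G r / r ^ (ν+1)) r := by
    intro r hr
    have hr0 : 0 < r := hL0.trans_lt hr.1
    refine ((DD.deriv_rho h ⟨hr0, hr.2.trans_le hρ1⟩).1.const_mul σ).congr_deriv ?_
    simp only [hG, fluxG]
    field_simp
  have dG : ∀ r ∈ Ioo L (ρ k), HasDerivAt G (-(w r ^ p * r ^ (ν+1))) r := by
    intro r hr
    have hr0 : 0 < r := hL0.trans_lt hr.1
    refine ((DD.flux_deriv h ⟨hr0, hr.2.trans_le hρ1⟩).const_mul σ).congr_deriv ?_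
    have h5 : |u r| = w r := by
      rw [← abs_of_pos (show 0 < w r from hpos r hr), hw]; simp only [abs_mul, habs, one_mul]
    rw [h5]
    have h6 : 0 < w r := hpos r hr
    rw [Real.rpow_sub_one h6.ne']
    have h7 : σ * u r = w r := rfl
    calc σ * -(w r ^ p / w r * u r * r ^ (ν+1)) = -(w r ^ p / w r * (σ * u r) * r ^ (ν+1)) := by ring
      _ = _ := by rw [h7]; field_simp
  have hsub : Icc L (ρ k) ⊆ Icc (0:ℝ) 1 := fun z hz => ⟨hL0.trans hz.1, hz.2.trans hρ1⟩
  have Gd : G (δ k) = 0 := by simp [hG, fluxG, hδu]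
  have wpos : 0 < w (δ k) := by
    rcases h2.lt_or_eq with hk | hk
    · exact hpos _ ⟨(hLk hk).2, hdr⟩
    · obtain ⟨hL', hδ'⟩ := hLm hk
      subst hL'
      by_contra hc
      rw [not_lt, hδ'] at hc
      rw [hδ'] at Gd
      have gneg : ∀ r ∈ Ioo (0:ℝ) (ρ k), G r ≤ 0 := by
        intro r hr
        rw [← Gd]
        refine anti_aux (cG.mono hsub) dG ?_ le_rfl hr.1.le hr.2.le
        intro s hs
        have := (Real.rpow_pos_of_pos (hpos s hs) p)
        have hs0 := hs.1
        have : 0 < w s ^ p * s ^ (ν+1) := by positivity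
        linarith
      have hm : ρ k / 2 ∈ Ioo (0:ℝ) (ρ k) := ⟨by linarith, by linarith⟩
      have := anti_aux (cw.mono hsub) dw (fun s hs => by
        have hs0 := hs.1
        exact div_nonpos_of_nonpos_of_nonneg (gneg s hs) (by positivity)) le_rfl hm.1.le hm.2.le
      have := hpos _ hm
      simp only [hw] at *
      linarith
  have wd : w (δ k) = |u (δ k)| := by
    rw [← abs_of_pos wpos, hw]; simp only [abs_mul, habs, one_mul]
  refine ⟨by rw [← wd]; exact wpos, ?_⟩
  intro l hl
  have hα : 0 < |u (δ k)| := by rw [← wd]; exact wpos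
  have hl0 : 0 < l := by rw [hl]; exact Real.rpow_pos_of_pos hα _
  have hR := RArc.scale (ν := ν) hα hl hδ0 hdr
    (cw.mono (fun z hz => ⟨hδ0.trans hz.1, hz.2.trans hρ1⟩))
    (cG.mono (fun z hz => ⟨hδ0.trans hz.1, hz.2.trans hρ1⟩))
    (fun r hr => dw r ⟨hLd.trans_lt hr.1, hr.2⟩)
    (fun r hr => dG r ⟨hLd.trans_lt hr.1, hr.2⟩)
    (fun r hr => hpos r ⟨hLd.trans_lt hr.1, hr.2⟩) wd Gd (by simp [hw, hρu])
  refine ⟨_, _, hR, ?_, ?_⟩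
  · have h5 := hR.g_nonpos hR.hdb.le le_rfl
    rw [← abs_of_nonpos h5]
    simp only [mul_div_cancel₀ _ hl0.ne', hG]
    rw [abs_div, abs_mul, habs, one_mul, abs_of_pos (a := _ * _) (by positivity)]
  · intro hk
    obtain ⟨hL', hLlt⟩ := hLk hk
    obtain ⟨hρ0', hρ1', hρu'⟩ := DD.rho_mem h (by omega : 1 ≤ k+1) (by omega)
    rw [← hL'] at hρ0' hρ1' hρu' ⊢
    have hLA := LArc.scale (ν := ν) hα hl hρ0' hLlt
      (cw.mono (fun z hz => ⟨hL0.trans hz.1, hz.2.trans hδ1⟩))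
      (cG.mono (fun z hz => ⟨hL0.trans hz.1, hz.2.trans hδ1⟩))
      (fun r hr => dw r ⟨hr.1, hr.2.trans hdr⟩)
      (fun r hr => dG r ⟨hr.1, hr.2.trans hdr⟩)
      (fun r hr => hpos r ⟨hr.1, hr.2.trans hdr⟩) wd Gd (by simp [hw, hρu'])
    refine ⟨hLA, ?_⟩
    have h5 := hLA.g_nonneg le_rfl hLA.had.le
    rw [← abs_of_nonneg h5]
    simp only [mul_div_cancel₀ _ hl0.ne', hG]
    rw [abs_div, abs_mul, habs, one_mul, abs_of_pos (a := _ * _) (by positivity)]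

end data

section stage
variable {ν m : ℕ} {u : ℝ → ℝ → ℝ} {ρ δ : ℝ → ℕ → ℝ}

/-- height of the k-th bump -/
def hgt (u : ℝ → ℝ → ℝ) (δ : ℝ → ℕ → ℝ) (k : ℕ) (ε : ℝ) : ℝ := |u ε (δ ε k)|
/-- length scale of the k-th bump -/
def scl (ν : ℕ) (u : ℝ → ℝ → ℝ) (δ : ℝ → ℕ → ℝ) (k : ℕ) (ε : ℝ) : ℝ :=
  hgt u δ k ε ^ (-((pp ν ε - 1)/2))
/-- flux at the k-th zero -/
def flx (ν : ℕ) (u : ℝ → ℝ → ℝ) (ρ : ℝ → ℕ → ℝ) (k : ℕ) (ε : ℝ) : ℝ := |fluxG ν (u ε) (ρ ε k)|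
/-- rescaled flux -/
def gh (ν : ℕ) (u : ℝ → ℝ → ℝ) (ρ δ : ℝ → ℕ → ℝ) (k : ℕ) (ε : ℝ) : ℝ :=
  flx ν u ρ k ε / (hgt u δ k ε * scl ν u δ k ε ^ ν)

/-- right-end limits -/
def PR (ν m : ℕ) (u : ℝ → ℝ → ℝ) (ρ δ : ℝ → ℕ → ℝ) (k : ℕ) : Prop :=
  Tendsto (gh ν u ρ δ k) (𝓝[>] (0:ℝ)) (𝓝 (Cc ν)) ∧
  Tendsto (fun ε => gh ν u ρ δ k ε ^ 2 / (ρ ε k / scl ν u δ k ε) ^ ν / 2 / ε) (𝓝[>] (0:ℝ))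
    (𝓝 (E0 ν * ((m:ℝ) - k + 1)))

/-- left-end limits -/
def PL (ν : ℕ) (u : ℝ → ℝ → ℝ) (ρ δ : ℝ → ℕ → ℝ) (k : ℕ) : Prop :=
  Tendsto (fun ε => ε * Real.log (hgt u δ (k+1) ε / hgt u δ k ε)) (𝓝[>] (0:ℝ)) (𝓝 0) ∧
  Tendsto (fun ε => hgt u δ (k+1) ε / hgt u δ k ε * gh ν u ρ δ (k+1) ε /
    (ν * (ρ ε (k+1) / scl ν u δ (k+1) ε) ^ ν)) (𝓝[>] (0:ℝ)) (𝓝 1) ∧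
  Tendsto (fun ε => (δ ε k / scl ν u δ k ε) ^ (ν+2) /
    (((ν:ℝ)+2) * ν * (ρ ε (k+1) / scl ν u δ k ε) ^ ν)) (𝓝[>] (0:ℝ)) (𝓝 1)

lemma arcs_ev (hD : ∀ᶠ ε in 𝓝[>] (0:ℝ), DirichletData (ν+2) (pp ν ε) m (u ε) (ρ ε) (δ ε))
    {k : ℕ} (h1 : 1 ≤ k) (h2 : k ≤ m) :
    ∃ v g : ℝ → ℝ → ℝ, ∀ᶠ ε in 𝓝[>] (0:ℝ), 0 < hgt u δ k ε ∧ 0 < scl ν u δ k ε ∧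
      RArc ν (pp ν ε) (δ ε k / scl ν u δ k ε) (ρ ε k / scl ν u δ k ε) (v ε) (g ε) ∧
      - g ε (ρ ε k / scl ν u δ k ε) = gh ν u ρ δ k ε ∧
      (k < m → LArc ν (pp ν ε) (ρ ε (k+1) / scl ν u δ k ε) (δ ε k / scl ν u δ k ε) (v ε) (g ε) ∧
        g ε (ρ ε (k+1) / scl ν u δ k ε) =
          flx ν u ρ (k+1) ε / (hgt u δ k ε * scl ν u δ k ε ^ ν)) := by
  have key : ∀ ε, ∃ v g : ℝ → ℝ, DirichletData (ν+2) (pp ν ε) m (u ε) (ρ ε) (δ ε) →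
      0 < hgt u δ k ε ∧ 0 < scl ν u δ k ε ∧
      RArc ν (pp ν ε) (δ ε k / scl ν u δ k ε) (ρ ε k / scl ν u δ k ε) v g ∧
      - g (ρ ε k / scl ν u δ k ε) = gh ν u ρ δ k ε ∧
      (k < m → LArc ν (pp ν ε) (ρ ε (k+1) / scl ν u δ k ε) (δ ε k / scl ν u δ k ε) v g ∧
        g (ρ ε (k+1) / scl ν u δ k ε) =
          flx ν u ρ (k+1) ε / (hgt u δ k ε * scl ν u δ k ε ^ ν)) := by
    intro ε
    by_cases hd : DirichletData (ν+2) (pp ν ε) m (u ε) (ρ ε) (δ ε)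
    · obtain ⟨h3, h4⟩ := DD.arcs hd h1 h2
      obtain ⟨v, g, h5, h6, h7⟩ := h4 (scl ν u δ k ε) rfl
      exact ⟨v, g, fun _ => ⟨h3, Real.rpow_pos_of_pos h3 _, h5, h6, h7⟩⟩
    · exact ⟨0, 0, fun hc => absurd hc hd⟩
  choose v g hvg using key
  exact ⟨v, g, hD.mono fun ε h => hvg ε h⟩

lemma PR_of (hν : 1 ≤ ν) {k : ℕ} {v g : ℝ → ℝ → ℝ}
    (hR : ∀ᶠ ε in 𝓝[>] (0:ℝ), RArc ν (pp ν ε) (δ ε k / scl ν u δ k ε) (ρ ε k / scl ν u δ k ε) (v ε) (g ε))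
    (hg : ∀ᶠ ε in 𝓝[>] (0:ℝ), - g ε (ρ ε k / scl ν u δ k ε) = gh ν u ρ δ k ε)
    (hd0 : Tendsto (fun ε => δ ε k / scl ν u δ k ε) (𝓝[>] (0:ℝ)) (𝓝 0))
    (ht : Tendsto (fun ε => (δ ε k / scl ν u δ k ε) ^ (ν+2) / (pp ν ε + 1) / ε) (𝓝[>] (0:ℝ))
      (𝓝 (E0 ν * ((m:ℝ) - k)))) : PR ν m u ρ δ k := by
  constructor
  · exact (RArc.g_lim hν hR hd0).congr' hg
  · have := RArc.e_lim hν hR hd0 ht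
    have e : E0 ν * ((m:ℝ) - k) + E0 ν = E0 ν * ((m:ℝ) - k + 1) := by ring
    rw [e] at this
    refine this.congr' ?_
    filter_upwards [hg] with ε h
    rw [← h, neg_sq]

lemma step (hν : 1 ≤ ν) (hm : 1 ≤ m)
    (hD : ∀ᶠ ε in 𝓝[>] (0:ℝ), DirichletData (ν+2) (pp ν ε) m (u ε) (ρ ε) (δ ε))
    {k : ℕ} (h1 : 1 ≤ k) (h2 : k < m) (hP : PR ν m u ρ δ (k+1)) :
    PR ν m u ρ δ k ∧ PL ν u ρ δ k := by
  obtain ⟨v, g, hvg⟩ := arcs_ev hD h1 h2.le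
  obtain ⟨v', g', hvg'⟩ := arcs_ev hD (by omega : 1 ≤ k+1) (by omega)
  have hν0 : (0:ℝ) < ν := by positivity
  have hL := hvg.mono fun ε h => (h.2.2.2.2 h2).1
  have hkm : (0:ℝ) < (m:ℝ) - k := by
    have : (k:ℝ) < m := by exact_mod_cast h2
    linarith
  have hT : 0 < E0 ν * ((m:ℝ) - k) := mul_pos (E0_pos hν) hkm
  have he := hP.2
  have e0 : E0 ν * ((m:ℝ) - (k+1:ℕ) + 1) = E0 ν * ((m:ℝ) - k) := by push_cast; ring
  rw [e0] at he
  have hlink := LArc.link hν hL (b := fun ε => ρ ε (k+1) / scl ν u δ (k+1) ε)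
    (G := gh ν u ρ δ (k+1)) (A := fun ε => hgt u δ (k+1) ε / hgt u δ k ε) hT
  obtain ⟨l1, l2, l3⟩ := hlink (by
      filter_upwards [hvg'] with ε h
      exact h.2.2.1.hd.trans_lt h.2.2.1.hdb) (by
      filter_upwards [hvg, hvg'] with ε h h'
      exact div_pos h'.1 h.1) (by
      filter_upwards [hvg, hvg'] with ε h h'
      rw [Real.div_rpow h'.1.le h.1.le]
      change _ = _ * (scl ν u δ (k+1) ε / scl ν u δ k ε)
      have := h.2.1
      have := h'.2.1
      field_simp) (by
      filter_upwards [hvg, hvg'] with ε h h'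
      rw [(h.2.2.2.2 h2).2]
      have hA := div_pos h'.1 h.1
      have e : (hgt u δ (k+1) ε / hgt u δ k ε) ^ (1 - ν * ((pp ν ε - 1)/2)) =
          (hgt u δ (k+1) ε / hgt u δ k ε) * (scl ν u δ (k+1) ε / scl ν u δ k ε) ^ ν := by
        have : scl ν u δ (k+1) ε / scl ν u δ k ε =
            (hgt u δ (k+1) ε / hgt u δ k ε) ^ (-((pp ν ε - 1)/2)) := by
          rw [Real.div_rpow h'.1.le h.1.le]; rfl
        rw [this, ← Real.rpow_natCast, ← Real.rpow_mul hA.le]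
        rw [show 1 - (ν:ℝ)*((pp ν ε-1)/2) = 1 + -((pp ν ε-1)/2)*(ν:ℝ) by ring, Real.rpow_add hA,
          Real.rpow_one]
      rw [e, div_pow]
      unfold gh
      have h3 := h.2.1
      have h3' := h'.2.1
      have h4 := h.1
      have h4' := h'.1
      field_simp) hP.1 he
  · have hd0 := LArc.d_lim hν hL l2
    have hdn := LArc.dn_lim hν hL l2
    refine ⟨PR_of hν (hvg.mono fun ε h => h.2.2.1) (hvg.mono fun ε h => h.2.2.2.1) hd0 hdn, l1, ?_, ?_⟩
    · exact (LArc.x_lim hν hL l2).congr' l3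
    · have h5 := (LArc.x_lim hν hL l2).div (LArc.gd_lim hν hL l2) one_ne_zero
      rw [div_one] at h5
      refine h5.congr' ?_
      filter_upwards [hL] with ε h
      have ha := h.ha
      have hx := h.x_ge hν
      have hg0 : 0 < g ε (ρ ε (k+1) / scl ν u δ k ε) := lt_of_lt_of_le (by positivity) hx
      have hd := ha.trans h.had
      simp only [Pi.div_apply]
      field_simp

lemma all_stages (hν : 1 ≤ ν) (hm : 1 ≤ m)
    (hD : ∀ᶠ ε in 𝓝[>] (0:ℝ), DirichletData (ν+2) (pp ν ε) m (u ε) (ρ ε) (δ ε)) :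
    ∀ j k : ℕ, k + j = m → 1 ≤ k → PR ν m u ρ δ k ∧ (k < m → PL ν u ρ δ k) := by
  intro j
  induction j with
  | zero =>
    intro k hk h1
    have hk : k = m := by omega
    subst hk
    refine ⟨?_, fun hc => absurd hc (lt_irrefl _)⟩
    obtain ⟨v, g, hvg⟩ := arcs_ev hD h1 le_rfl
    have hz : ∀ᶠ ε in 𝓝[>] (0:ℝ), δ ε k / scl ν u δ k ε = 0 := by
      filter_upwards [hD] with ε h
      rw [h.2.2.2.1, zero_div]
    refine PR_of hν (hvg.mono fun ε h => h.2.2.1) (hvg.mono fun ε h => h.2.2.2.1) ?_ ?_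
    · exact tendsto_const_nhds.congr' (hz.mono fun ε h => h.symm)
    · rw [sub_self, mul_zero]
      refine tendsto_const_nhds.congr' (hz.mono fun ε h => ?_)
      show (0:ℝ) = (δ ε k / scl ν u δ k ε)^(ν+2)/(pp ν ε+1)/ε
      rw [h]; simp
  | succ j ih =>
    intro k hk h1
    have := step hν hm hD h1 (by omega) (ih (k+1) (by omega) (by omega)).1
    exact ⟨this.1, fun _ => this.2⟩

end stage

lemma tl {l : Filter ℝ} {f g : ℝ → ℝ} {x y : ℝ} (h : Tendsto f l (𝓝 x)) (e1 : ∀ ε, f ε = g ε)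
    (e2 : x = y) : Tendsto g l (𝓝 y) := by
  rw [← e2]; exact h.congr e1

/-- the constant `H_k` -/
def Hc (m k : ℕ) : ℝ :=
  Real.log (Real.Gamma ((m:ℝ) - k + 1)) - Real.log m / 2 - Real.log (Real.Gamma m)

lemma Hc_succ {m k : ℕ} (h : k < m) : Hc m (k+1) = Hc m k - Real.log ((m:ℝ) - k) := by
  have h0 : (0:ℝ) < (m:ℝ) - k := by
    have : (k:ℝ) < m := by exact_mod_cast h
    linarith
  unfold Hc
  have e : (m:ℝ) - (k+1:ℕ) + 1 = (m:ℝ) - k := by push_cast; ring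
  rw [e, Real.Gamma_add_one h0.ne', Real.log_mul h0.ne' (Real.Gamma_pos_of_pos h0).ne']
  ring

lemma Hc_one {m : ℕ} (h : 1 ≤ m) : Hc m 1 = - Real.log m / 2 := by
  unfold Hc
  rw [show (m:ℝ) - (1:ℕ) + 1 = m by push_cast; ring]; ring

section logs
variable {m : ℕ} {ν lk lC lE lN lv : ℝ} {a g r d : ℕ → ℝ → ℝ}

lemma eps_log : Tendsto (fun ε : ℝ => ε * Real.log ε) (𝓝[>] (0:ℝ)) (𝓝 0) := by
  have := tendsto_log_mul_rpow_nhdsGT_zero (r := 1) one_pos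
  refine this.congr fun ε => ?_
  rw [Real.rpow_one]; ring

/-- the collection of logarithmic limits -/
structure LD (m : ℕ) (ν lC lE lN : ℝ) (a g r d : ℕ → ℝ → ℝ) : Prop where
  h1 : ∀ k, 1 ≤ k → k ≤ m →
    Tendsto (fun ε => g k ε + a k ε - ν/2*(ε * a k ε)) (𝓝[>] (0:ℝ)) (𝓝 lC)
  h2 : ∀ k, 1 ≤ k → k ≤ m →
    Tendsto (fun ε => 2*(g k ε + a k ε - ν/2*(ε * a k ε)) - (ν * r k ε + 2 * a k ε - ν/2*(ε * a k ε))
      - Real.log 2 - Real.log ε) (𝓝[>] (0:ℝ)) (𝓝 (lE + Real.log ((m:ℝ) - k + 1)))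
  h3 : ∀ k, 1 ≤ k → k < m →
    Tendsto (fun ε => ε * (a (k+1) ε - a k ε)) (𝓝[>] (0:ℝ)) (𝓝 0)
  h4 : ∀ k, 1 ≤ k → k < m →
    Tendsto (fun ε => a (k+1) ε - a k ε + (g (k+1) ε + a (k+1) ε - ν/2*(ε * a (k+1) ε)) - Real.log ν
      - (ν * r (k+1) ε + 2 * a (k+1) ε - ν/2*(ε * a (k+1) ε))) (𝓝[>] (0:ℝ)) (𝓝 0)
  h5 : ∀ k, 1 ≤ k → k < m →
    Tendsto (fun ε => (ν+2) * d k ε - ν * r (k+1) ε + 4/ν * a k ε - ε * a k ε - lN) (𝓝[>] (0:ℝ)) (𝓝 0)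
  hr : ∀ᶠ ε in 𝓝[>] (0:ℝ), r 1 ε = 0

namespace LD

lemma ea (hν : 0 < ν) (hm : 1 ≤ m) (h : LD m ν lC lE lN a g r d) : ∀ k, 1 ≤ k → k ≤ m →
    Tendsto (fun ε => ε * a k ε) (𝓝[>] (0:ℝ)) (𝓝 0) := by
  have hid : Tendsto (fun ε : ℝ => ε) (𝓝[>] (0:ℝ)) (𝓝 0) := tendsto_nhdsWithin_of_tendsto_nhds tendsto_id
  have base : Tendsto (fun ε => ε * a 1 ε) (𝓝[>] (0:ℝ)) (𝓝 0) := by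
    have e1 := (((h.h1 1 le_rfl hm).const_mul 2).sub (h.h2 1 le_rfl hm)).sub_const (Real.log 2)
    have e2 := (hid.mul e1).sub eps_log
    have e3 : Tendsto (fun ε : ℝ => 2 - ν/2*ε) (𝓝[>] (0:ℝ)) (𝓝 (2 - ν/2*0)) :=
      (hid.const_mul (ν/2)).const_sub 2
    have e4 := e2.div e3 (by norm_num)
    have e5 : ∀ᶠ ε in 𝓝[>] (0:ℝ), 2 - ν/2*ε ≠ 0 := e3.eventually_ne (by norm_num)
    have e6 := e4.congr' (f₂ := fun ε => ε * a 1 ε) (by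
      filter_upwards [e5, h.hr] with ε h5 hr
      simp only [Pi.div_apply]
      rw [div_eq_iff h5, hr]; ring)
    simpa using e6
  intro k h1
  induction k, h1 using Nat.le_induction with
  | base => intro _; exact base
  | succ k hk ih =>
    intro h2
    exact tl ((ih (by omega)).add (h.h3 k hk (by omega))) (fun ε => by ring) (by ring)

lemma r_lim (hν : 0 < ν) (hm : 1 ≤ m) (h : LD m ν lC lE lN a g r d)
    {k : ℕ} (h1 : 1 ≤ k) (h2 : k ≤ m) :
    Tendsto (fun ε => ν * r k ε + 2 * a k ε + Real.log ε) (𝓝[>] (0:ℝ))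
      (𝓝 (2*lC - Real.log 2 - lE - Real.log ((m:ℝ) - k + 1))) :=
  tl (((((h.h1 k h1 h2).const_mul 2).sub (h.h2 k h1 h2)).sub_const (Real.log 2)).add
    ((ea hν hm h k h1 h2).const_mul (ν/2))) (fun ε => by ring) (by ring)

lemma a_step (hν : 0 < ν) (hm : 1 ≤ m) (h : LD m ν lC lE lN a g r d)
    {k : ℕ} (h1 : 1 ≤ k) (h2 : k < m) :
    Tendsto (fun ε => a (k+1) ε - a k ε + Real.log ε) (𝓝[>] (0:ℝ))
      (𝓝 (lC + Real.log ν - Real.log 2 - lE - Real.log ((m:ℝ) - k))) :=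
  tl (((h.h4 k h1 h2).add (r_lim hν hm h (by omega : 1 ≤ k+1) (by omega))).sub
    (((h.h1 (k+1) (by omega) (by omega))).add
      ((ea hν hm h (k+1) (by omega) (by omega)).const_mul (ν/2)))|>.add_const (Real.log ν))
    (fun ε => by ring) (by
      rw [show (m:ℝ) - (k+1:ℕ) + 1 = (m:ℝ) - k by push_cast; ring]; ring)

lemma i (hν : 0 < ν) (hm : 1 ≤ m) (h : LD m ν lC lE lN a g r d)
    (hC : lC = Real.log ν + ν/2*lN) (hE : 2*lC - Real.log 2 - lE = ν/2*lN - lk) :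
    ∀ k, 1 ≤ k → k ≤ m →
    Tendsto (fun ε => a k ε + (2*(k:ℝ)-1)/2*(lk + Real.log ε)) (𝓝[>] (0:ℝ)) (𝓝 (ν/4*lN + Hc m k)) := by
  intro k h1
  induction k, h1 using Nat.le_induction with
  | base =>
    intro _
    have e := ((r_lim hν hm h le_rfl hm).add_const lk).const_mul (1/2)
    have e' := e.congr' (f₂ := fun ε => a 1 ε + (2*((1:ℕ):ℝ)-1)/2*(lk + Real.log ε)) (by
      filter_upwards [h.hr] with ε hr
      rw [hr]; push_cast; ring)
    refine tl e' (fun _ => rfl) ?_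
    rw [Hc_one hm, hE, show (m:ℝ) - (1:ℕ) + 1 = m by push_cast; ring]; ring
  | succ k hk ih =>
    intro h2
    refine tl ((ih (by omega)).add ((a_step hν hm h hk (by omega)).add_const lk))
      (fun ε => by push_cast; ring) ?_
    rw [Hc_succ (by omega)]
    linear_combination hE - hC

lemma iv (hν : 0 < ν) (hm : 1 ≤ m) (h : LD m ν lC lE lN a g r d)
    (hC : lC = Real.log ν + ν/2*lN) (hE : 2*lC - Real.log 2 - lE = ν/2*lN - lk)
    {k : ℕ} (h1 : 1 ≤ k) (h2 : k ≤ m) :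
    Tendsto (fun ε => r k ε + (-(2*((k:ℝ)-1))/ν)*(lk + Real.log ε)) (𝓝[>] (0:ℝ))
      (𝓝 (-1/ν * Real.log ((m:ℝ) - k + 1) + 2/ν*(-Hc m k))) := by
  refine tl ((((r_lim hν hm h h1 h2).add_const lk).sub ((i hν hm h hC hE k h1 h2).const_mul 2)).const_mul (1/ν))
    (fun ε => by field_simp; ring) ?_
  rw [hE]; field_simp; ring

lemma iii (hν : 0 < ν) (hm : 1 ≤ m) (h : LD m ν lC lE lN a g r d)
    (hC : lC = Real.log ν + ν/2*lN) (hE : 2*lC - Real.log 2 - lE = ν/2*lN - lk)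
    (hN : lN = Real.log (ν+2) + Real.log ν)
    {k : ℕ} (h1 : 1 ≤ k) (h2 : k ≤ m) :
    Tendsto (fun ε => g k ε - (ν+1) * r k ε +
        ((2*(k:ℝ)*(ν+2) - 3*(ν+2)+2)/(2*ν))*(lk + Real.log ε)) (𝓝[>] (0:ℝ))
      (𝓝 (ν/4 * Real.log (ν+2) + (ν+4)/4 * Real.log ν + (ν+1)/ν * Real.log ((m:ℝ) - k + 1)
        + (ν+2)/ν * Hc m k)) := by
  refine tl ((((h.h1 k h1 h2).add ((ea hν hm h k h1 h2).const_mul (ν/2))).sub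
    (i hν hm h hC hE k h1 h2)).sub ((iv hν hm h hC hE h1 h2).const_mul (ν+1)))
    (fun ε => by field_simp; ring) ?_
  rw [hC, hN]; field_simp; ring

lemma ii (hν : 0 < ν) (hm : 1 ≤ m) (h : LD m ν lC lE lN a g r d)
    (hC : lC = Real.log ν + ν/2*lN) (hE : 2*lC - Real.log 2 - lE = ν/2*lN - lk)
    {k : ℕ} (h1 : 1 ≤ k) (h2 : k < m) :
    Tendsto (fun ε => d k ε + (-(2*((k:ℝ)*(ν+2)-1))/((ν+2)*ν))*(lk + Real.log ε)) (𝓝[>] (0:ℝ))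
      (𝓝 (1/(ν+2) * Real.log ((m:ℝ) - k) + 2/ν*(-Hc m k))) := by
  refine tl (((((h.h5 k h1 h2).add (ea hν hm h k h1 h2.le)).add
    ((iv hν hm h hC hE (by omega : 1 ≤ k+1) (by omega)).const_mul ν)).sub
    ((i hν hm h hC hE k h1 h2.le).const_mul (4/ν))|>.add_const lN).const_mul (1/(ν+2)))
    (fun ε => by push_cast; field_simp; ring) ?_
  rw [Hc_succ h2, show (m:ℝ) - (k+1:ℕ) + 1 = (m:ℝ) - k by push_cast; ring]
  field_simp; ring

end LD
end logs

section final
variable {ν m : ℕ} {u : ℝ → ℝ → ℝ} {ρ δ : ℝ → ℕ → ℝ}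

lemma pos_ev (hν : 1 ≤ ν) (hm : 1 ≤ m)
    (hD : ∀ᶠ ε in 𝓝[>] (0:ℝ), DirichletData (ν+2) (pp ν ε) m (u ε) (ρ ε) (δ ε))
    {k : ℕ} (h1 : 1 ≤ k) (h2 : k ≤ m) :
    ∀ᶠ ε in 𝓝[>] (0:ℝ), 0 < ε ∧ 0 < hgt u δ k ε ∧ 0 < flx ν u ρ k ε ∧ 0 < ρ ε k ∧
      (k < m → 0 < δ ε k) := by
  obtain ⟨v, g, hvg⟩ := arcs_ev hD h1 h2
  have hP := (all_stages hν hm hD (m-k) k (by omega) h1).1.1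
  filter_upwards [hvg, hD, hP.eventually (lt_mem_nhds (Cc_pos hν)), self_mem_nhdsWithin] with ε h hd hp he
  refine ⟨he, h.1, ?_, (DD.rho_mem hd h1 h2).1, fun hk => ?_⟩
  · unfold gh at hp
    have := mul_pos h.1 (pow_pos h.2.1 ν)
    exact (div_pos_iff_of_pos_right this).1 hp
  · exact (DD.rho_mem hd (by omega : 1 ≤ k+1) (by omega)).1.trans (hd.2.2.2.2.2.1 k h1 (by omega))

lemma log_scl {k : ℕ} {ε : ℝ} (h : 0 < hgt u δ k ε) :
    Real.log (scl ν u δ k ε) = -((pp ν ε - 1)/2) * Real.log (hgt u δ k ε) := by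
  unfold scl; rw [Real.log_rpow h]

lemma scl_pos {k : ℕ} {ε : ℝ} (h : 0 < hgt u δ k ε) : 0 < scl ν u δ k ε :=
  Real.rpow_pos_of_pos h _

lemma log_gh (hν : 1 ≤ ν) {k : ℕ} {ε : ℝ} (h : 0 < hgt u δ k ε) (h' : 0 < flx ν u ρ k ε) :
    Real.log (gh ν u ρ δ k ε) = Real.log (flx ν u ρ k ε) + Real.log (hgt u δ k ε)
      - (ν:ℝ)/2*(ε * Real.log (hgt u δ k ε)) := by
  have hs := scl_pos (ν := ν) h
  have hν0 : (0:ℝ) < ν := by positivity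
  unfold gh
  rw [Real.log_div h'.ne' (by positivity), Real.log_mul h.ne' (by positivity), Real.log_pow, log_scl h, pp]
  field_simp; ring

lemma log_b (hν : 1 ≤ ν) {k : ℕ} {ε x : ℝ} (h : 0 < hgt u δ k ε) (hx : 0 < x) :
    Real.log (x / scl ν u δ k ε) = Real.log x + 2/(ν:ℝ) * Real.log (hgt u δ k ε)
      - 1/2*(ε * Real.log (hgt u δ k ε)) := by
  have hs := scl_pos (ν := ν) h
  have hν0 : (0:ℝ) < ν := by positivity
  rw [Real.log_div hx.ne' hs.ne', log_scl h, pp]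
  field_simp; ring

lemma mkLD (hν : 1 ≤ ν) (hm : 1 ≤ m)
    (hD : ∀ᶠ ε in 𝓝[>] (0:ℝ), DirichletData (ν+2) (pp ν ε) m (u ε) (ρ ε) (δ ε)) :
    LD m ν (Real.log (Cc ν)) (Real.log (E0 ν)) (Real.log (((ν:ℝ)+2)*ν))
      (fun k ε => Real.log (hgt u δ k ε)) (fun k ε => Real.log (flx ν u ρ k ε))
      (fun k ε => Real.log (ρ ε k)) (fun k ε => Real.log (δ ε k)) := by
  have hν0 : (0:ℝ) < ν := by positivity
  have hS := fun k (h1 : 1 ≤ k) (h2 : k ≤ m) => all_stages hν hm hD (m-k) k (by omega) h1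
  have hP := fun k (h1 : 1 ≤ k) (h2 : k ≤ m) => pos_ev hν hm hD h1 h2
  refine ⟨?_, ?_, ?_, ?_, ?_, ?_⟩
  · intro k h1 h2
    refine ((hS k h1 h2).1.1.log (Cc_pos hν).ne').congr' ?_
    filter_upwards [hP k h1 h2] with ε h
    exact log_gh hν h.2.1 h.2.2.1
  · intro k h1 h2
    have hk : (0:ℝ) < (m:ℝ) - k + 1 := by
      have : (k:ℝ) ≤ m := by exact_mod_cast h2
      linarith
    have := (hS k h1 h2).1.2.log (mul_pos (E0_pos hν) hk).ne'
    rw [Real.log_mul (E0_pos hν).ne' hk.ne'] at this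
    refine this.congr' ?_
    filter_upwards [hP k h1 h2] with ε h
    obtain ⟨he, ha, hg, hr, -⟩ := h
    have hs := scl_pos (ν := ν) ha
    have hgh : 0 < gh ν u ρ δ k ε := by unfold gh; positivity
    rw [Real.log_div (by positivity) he.ne', Real.log_div (by positivity) (by norm_num),
      Real.log_div (by positivity) (by positivity), Real.log_pow, Real.log_pow, log_gh hν ha hg,
      log_b hν ha hr]
    push_cast; field_simp
  · intro k h1 h2
    refine ((hS k h1 h2.le).2 h2).1.congr' ?_
    filter_upwards [hP k h1 h2.le, hP (k+1) (by omega) (by omega)] with ε h h'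
    rw [Real.log_div h'.2.1.ne' h.2.1.ne']
  · intro k h1 h2
    have := ((hS k h1 h2.le).2 h2).2.1.log one_ne_zero
    rw [Real.log_one] at this
    refine this.congr' ?_
    filter_upwards [hP k h1 h2.le, hP (k+1) (by omega) (by omega)] with ε h h'
    obtain ⟨he, ha, hg, hr, -⟩ := h
    obtain ⟨-, ha', hg', hr', -⟩ := h'
    have hs := scl_pos (ν := ν) ha
    have hs' := scl_pos (ν := ν) ha'
    have hgh : 0 < gh ν u ρ δ (k+1) ε := by unfold gh; positivity
    rw [Real.log_div (by positivity) (by positivity), Real.log_mul (by positivity) hgh.ne',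
      Real.log_div ha'.ne' ha.ne', Real.log_mul hν0.ne' (by positivity), Real.log_pow,
      log_gh hν ha' hg', log_b hν ha' hr']
    field_simp; ring
  · intro k h1 h2
    have := ((hS k h1 h2.le).2 h2).2.2.log one_ne_zero
    rw [Real.log_one] at this
    refine this.congr' ?_
    filter_upwards [hP k h1 h2.le, hP (k+1) (by omega) (by omega)] with ε h h'
    obtain ⟨he, ha, hg, hr, hd⟩ := h
    have hd := hd h2
    obtain ⟨-, ha', hg', hr', -⟩ := h'
    have hs := scl_pos (ν := ν) ha
    rw [Real.log_div (by positivity) (by positivity), Real.log_mul (by positivity) (by positivity),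
      Real.log_pow, Real.log_pow, log_b hν ha hd, log_b hν ha hr']
    push_cast; field_simp; ring
  · filter_upwards [hD] with ε h
    rw [h.2.2.1, Real.log_one]

lemma log_Cc (hν : 1 ≤ ν) : Real.log (Cc ν) = Real.log ν + (ν:ℝ)/2 * Real.log (((ν:ℝ)+2)*ν) := by
  have hν0 : (0:ℝ) < ν := by positivity
  unfold Cc
  rw [Real.log_div (by positivity) (by positivity), Real.log_rpow (by positivity),
    Real.log_mul (by positivity) (by positivity)]
  ring

lemma log_E0 (hν : 1 ≤ ν) : 2 * Real.log (Cc ν) - Real.log 2 - Real.log (E0 ν) =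
    (ν:ℝ)/2 * Real.log (((ν:ℝ)+2)*ν) - Real.log (kappa (ν+2)) := by
  have hν0 : (0:ℝ) < ν := by positivity
  have g1 := Real.Gamma_pos_of_pos (by positivity : 0 < ((ν:ℝ)+2)/2)
  have g2 := Real.Gamma_pos_of_pos (by positivity : 0 < (ν:ℝ)+2)
  have e : E0 ν = ν/(2*(ν+2)) * ((((ν:ℝ)+2)*ν)^(((ν:ℝ)+2)/2) * kappa (ν+2)) := by
    unfold E0 kappa
    push_cast
    rw [show (ν:ℝ)+2-2 = ν by ring]
    field_simp
  have hk : 0 < kappa (ν+2) := by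
    unfold kappa
    push_cast
    rw [show (ν:ℝ)+2-2 = ν by ring]
    positivity
  have hX : 0 < (((ν:ℝ)+2)*ν)^(((ν:ℝ)+2)/2) := by positivity
  have hY : (ν:ℝ)/(2*(ν+2)) ≠ 0 := by positivity
  have e2 : Real.log (E0 ν) = Real.log ν - (Real.log 2 + Real.log (ν+2)) +
      (((ν:ℝ)+2)/2 * Real.log (((ν:ℝ)+2)*ν) + Real.log (kappa (ν+2))) := by
    rw [e, Real.log_mul hY (mul_pos hX hk).ne', Real.log_mul hX.ne' hk.ne',
      Real.log_rpow (by positivity), Real.log_div (by positivity) (by positivity),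
      Real.log_mul (by norm_num) (by positivity)]
  have e3 : Real.log (((ν:ℝ)+2)*ν) = Real.log (ν+2) + Real.log ν :=
    Real.log_mul (by positivity) (by positivity)
  rw [log_Cc hν, e2, e3]
  ring

lemma kappa_pos (hν : 1 ≤ ν) : 0 < kappa (ν+2) := by
  have hν0 : (0:ℝ) < ν := by positivity
  have g1 := Real.Gamma_pos_of_pos (by positivity : 0 < ((ν:ℝ)+2)/2)
  have g2 := Real.Gamma_pos_of_pos (by positivity : 0 < (ν:ℝ)+2)
  unfold kappa
  push_cast
  rw [show (ν:ℝ)+2-2 = ν by ring]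
  positivity

/-- exponentiating a logarithmic limit -/
lemma exp_lim {K q c L : ℝ} {f F : ℝ → ℝ} (hK : 0 < K)
    (h : Tendsto (fun ε => F ε + q * (Real.log K + Real.log ε)) (𝓝[>] (0:ℝ)) (𝓝 c))
    (hf : ∀ᶠ ε in 𝓝[>] (0:ℝ), 0 < f ε ∧ Real.log (f ε) = F ε) (hL : 0 < L) (hc : c = Real.log L) :
    Tendsto (fun ε => f ε * (K * ε) ^ q) (𝓝[>] (0:ℝ)) (𝓝 L) := by
  have h1 := (Real.continuous_exp.tendsto c).comp h
  rw [hc, Real.exp_log hL] at h1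
  refine h1.congr' ?_
  filter_upwards [hf, self_mem_nhdsWithin] with ε h2 h3
  have h3 : 0 < ε := h3
  have : 0 < f ε * (K * ε) ^ q := mul_pos h2.1 (Real.rpow_pos_of_pos (by positivity) _)
  simp only [Function.comp]
  rw [← Real.exp_log this, Real.log_mul h2.1.ne' (Real.rpow_pos_of_pos (by positivity) _).ne',
    Real.log_rpow (by positivity), Real.log_mul hK.ne' h3.ne', h2.2]

lemma Hc_eq (hm : 1 ≤ m) {k : ℕ} (hk : k ≤ m) :
    0 < Real.Gamma ((m:ℝ) - k + 1) ∧ 0 < (m:ℝ) ^ ((1:ℝ)/2) * Real.Gamma m ∧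
    Real.log (Real.Gamma ((m:ℝ) - k + 1) / ((m:ℝ) ^ ((1:ℝ)/2) * Real.Gamma m)) = Hc m k ∧
    Real.log (((m:ℝ) ^ ((1:ℝ)/2) * Real.Gamma m) / Real.Gamma ((m:ℝ) - k + 1)) = - Hc m k := by
  have hm0 : (0:ℝ) < m := by positivity
  have hk' : (k:ℝ) ≤ m := by exact_mod_cast hk
  have h1 := Real.Gamma_pos_of_pos (by linarith : 0 < (m:ℝ) - k + 1)
  have h2 := Real.Gamma_pos_of_pos hm0
  have h3 : 0 < (m:ℝ) ^ ((1:ℝ)/2) := Real.rpow_pos_of_pos hm0 _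
  have h4 : Real.log (Real.Gamma ((m:ℝ) - k + 1) / ((m:ℝ) ^ ((1:ℝ)/2) * Real.Gamma m)) = Hc m k := by
    rw [Real.log_div h1.ne' (by positivity), Real.log_mul h3.ne' h2.ne', Real.log_rpow hm0, Hc]
    ring
  refine ⟨h1, by positivity, h4, ?_⟩
  rw [← h4, ← Real.log_inv, inv_div]

end final

/-- **Theorem 1.1 (Dirichlet case).** Sharp asymptotic rates and constants for the values
of a radial Dirichlet solution with `m-1` interior zeros at its critical points, the
positions of the critical points, the values of the derivative at the zeros, and the
positions of the zeros, as `ε → 0⁺`. -/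
theorem dirichlet_asymptotics (n m : ℕ) (hn : 3 ≤ n) (hm : 1 ≤ m)
    (u : ℝ → ℝ → ℝ) (ρ δ : ℝ → ℕ → ℝ)
    (hu : ∀ ε ∈ Set.Ioo (0 : ℝ) (4 / ((n : ℝ) - 2)),
      DirichletData n (pEps n ε) m (u ε) (ρ ε) (δ ε)) :
    (∀ k : ℕ, 1 ≤ k → k ≤ m →
      Tendsto (fun ε : ℝ => |u ε (δ ε k)| * (kappa n * ε) ^ ((2 * (k : ℝ) - 1) / 2))
        (𝓝[>] (0 : ℝ))
        (𝓝 (((n : ℝ) * ((n : ℝ) - 2)) ^ (((n : ℝ) - 2) / 4) *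
          Real.Gamma ((m : ℝ) - (k : ℝ) + 1) /
          ((m : ℝ) ^ ((1 : ℝ) / 2) * Real.Gamma (m : ℝ))))) ∧
    (2 ≤ m → ∀ k : ℕ, 1 ≤ k → k ≤ m - 1 →
      Tendsto (fun ε : ℝ => δ ε k *
          (kappa n * ε) ^ (-(2 * ((k : ℝ) * (n : ℝ) - 1)) / ((n : ℝ) * ((n : ℝ) - 2))))
        (𝓝[>] (0 : ℝ))
        (𝓝 (((m : ℝ) - (k : ℝ)) ^ ((1 : ℝ) / (n : ℝ)) *
          ((m : ℝ) ^ ((1 : ℝ) / 2) * Real.Gamma (m : ℝ) /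
            Real.Gamma ((m : ℝ) - (k : ℝ) + 1)) ^ ((2 : ℝ) / ((n : ℝ) - 2))))) ∧
    (∀ k : ℕ, 1 ≤ k → k ≤ m →
      Tendsto (fun ε : ℝ => |deriv (u ε) (ρ ε k)| *
          (kappa n * ε) ^ ((2 * (k : ℝ) * (n : ℝ) - 3 * (n : ℝ) + 2) / (2 * ((n : ℝ) - 2))))
        (𝓝[>] (0 : ℝ))
        (𝓝 ((n : ℝ) ^ (((n : ℝ) - 2) / 4) * ((n : ℝ) - 2) ^ (((n : ℝ) + 2) / 4) *
          ((m : ℝ) - (k : ℝ) + 1) ^ (((n : ℝ) - 1) / ((n : ℝ) - 2)) *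
          (Real.Gamma ((m : ℝ) - (k : ℝ) + 1) /
            ((m : ℝ) ^ ((1 : ℝ) / 2) * Real.Gamma (m : ℝ))) ^ ((n : ℝ) / ((n : ℝ) - 2))))) ∧
    (2 ≤ m → ∀ k : ℕ, 2 ≤ k → k ≤ m →
      Tendsto (fun ε : ℝ => ρ ε k *
          (kappa n * ε) ^ (-(2 * ((k : ℝ) - 1)) / ((n : ℝ) - 2)))
        (𝓝[>] (0 : ℝ))
        (𝓝 (((m : ℝ) - (k : ℝ) + 1) ^ (-(1 : ℝ) / ((n : ℝ) - 2)) *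
          ((m : ℝ) ^ ((1 : ℝ) / 2) * Real.Gamma (m : ℝ) /
            Real.Gamma ((m : ℝ) - (k : ℝ) + 1)) ^ ((2 : ℝ) / ((n : ℝ) - 2))))) := by
  obtain ⟨ν, rfl⟩ : ∃ ν, n = ν + 2 := ⟨n - 2, by omega⟩
  have hν : 1 ≤ ν := by omega
  have hν0 : (0:ℝ) < ν := by positivity
  have ec : ((ν + 2 : ℕ) : ℝ) = (ν:ℝ) + 2 := by push_cast; ring
  have es : (ν:ℝ) + 2 - 2 = ν := by ring
  have hD : ∀ᶠ ε in 𝓝[>] (0:ℝ), DirichletData (ν+2) (pp ν ε) m (u ε) (ρ ε) (δ ε) := by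
    have h4 : (0:ℝ) < 4 / (((ν + 2 : ℕ) : ℝ) - 2) := by rw [ec, es]; positivity
    filter_upwards [Ioo_mem_nhdsGT h4] with ε hε
    have := hu ε hε
    have e : pEps (ν+2) ε = pp ν ε := by
      unfold pEps pp
      rw [ec, es, show (ν:ℝ) + 2 + 2 = ν + 4 by ring]
    rwa [e] at this
  have hLD := mkLD hν hm hD
  have hC := log_Cc hν
  have hE := log_E0 hν
  have hK := kappa_pos hν
  have hN : Real.log (((ν:ℝ)+2)*ν) = Real.log (ν+2) + Real.log ν :=
    Real.log_mul (by positivity) (by positivity)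
  rw [ec, es]
  refine ⟨?_, ?_, ?_, ?_⟩
  · intro k h1 h2
    obtain ⟨g1, g2, g3, g4⟩ := Hc_eq hm h2
    rw [mul_div_assoc]
    refine exp_lim hK (LD.i hν0 hm hLD hC hE k h1 h2) ?_ (by positivity) ?_
    · filter_upwards [pos_ev hν hm hD h1 h2] with ε h
      exact ⟨h.2.1, rfl⟩
    · rw [Real.log_mul (by positivity) (div_pos g1 g2).ne', g3, Real.log_rpow (by positivity)]
  · intro _ k h1 h2
    have h2' : k < m := by omega
    have hk : (0:ℝ) < (m:ℝ) - k := by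
      have : (k:ℝ) < m := by exact_mod_cast h2'
      linarith
    obtain ⟨g1, g2, g3, g4⟩ := Hc_eq hm h2'.le
    refine exp_lim hK (LD.ii hν0 hm hLD hC hE h1 h2') ?_ (by positivity) ?_
    · filter_upwards [pos_ev hν hm hD h1 h2'.le] with ε h
      exact ⟨h.2.2.2.2 h2', rfl⟩
    · rw [Real.log_mul (by positivity) (by positivity), Real.log_rpow hk,
        Real.log_rpow (div_pos g2 g1), g4]
  · intro k h1 h2
    have hk : (0:ℝ) < (m:ℝ) - k + 1 := by
      have : (k:ℝ) ≤ m := by exact_mod_cast h2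
      linarith
    obtain ⟨g1, g2, g3, g4⟩ := Hc_eq hm h2
    rw [show (ν:ℝ) + 2 + 2 = ν + 4 by ring, show (ν:ℝ) + 2 - 1 = ν + 1 by ring]
    refine exp_lim hK (LD.iii hν0 hm hLD hC hE hN h1 h2) ?_ (by positivity) ?_
    · filter_upwards [pos_ev hν hm hD h1 h2] with ε h
      obtain ⟨-, -, hg, hr, -⟩ := h
      have hg' : flx ν u ρ k ε = ρ ε k ^ (ν+1) * |deriv (u ε) (ρ ε k)| := by
        unfold flx fluxG
        rw [abs_mul, abs_of_pos (pow_pos hr _)]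
      have hd : 0 < |deriv (u ε) (ρ ε k)| := by
        rw [hg'] at hg
        exact (mul_pos_iff_of_pos_left (pow_pos hr _)).1 hg
      refine ⟨hd, ?_⟩
      rw [hg', Real.log_mul (pow_pos hr _).ne' hd.ne', Real.log_pow]
      push_cast; ring
    · rw [Real.log_mul (by positivity) (by positivity), Real.log_mul (by positivity) (by positivity),
        Real.log_mul (by positivity) (by positivity), Real.log_rpow hk, Real.log_rpow (div_pos g1 g2), g3,
        Real.log_rpow (by positivity), Real.log_rpow hν0]
  · intro _ k h1 h2
    have hk : (0:ℝ) < (m:ℝ) - k + 1 := by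
      have : (k:ℝ) ≤ m := by exact_mod_cast h2
      linarith
    obtain ⟨g1, g2, g3, g4⟩ := Hc_eq hm h2
    refine exp_lim hK (LD.iv hν0 hm hLD hC hE (by omega : 1 ≤ k) h2) ?_ (by positivity) ?_
    · filter_upwards [pos_ev hν hm hD (by omega : 1 ≤ k) h2] with ε h
      exact ⟨h.2.2.2.1, rfl⟩
    · rw [Real.log_mul (by positivity) (by positivity), Real.log_rpow hk,
        Real.log_rpow (div_pos g2 g1), g4]
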